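/- arXiv:1310.4113 — 5 statements merged into one kernel-verified Lean document; each statement's English description precedes it below -/
import Mathlib

section
/- For any two projection games G and H, ‖G⊗H‖*² ≤ val₊*(G)·‖H‖*². -/
noncomputable section
open scoped Kronecker ComplexOrder
open Matrix

/-- `d × d` complex matrices. -/
abbrev Mat (d : ℕ) := Matrix (Fin d) (Fin d) ℂ

/-- Entrywise complex conjugation of a matrix. -/
def mconj {m n : Type*} (M : Matrix m n ℂ) : Matrix m n ℂ := M.map (starRingEnd ℂ)

/-- Operator (spectral) norm of a square complex matrix. -/
noncomputable def opNorm {n : Type*} [Fintype n] [DecidableEq n] (M : Matrix n n ℂ) : ℝ :=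
  ‖Matrix.toEuclideanCLM (𝕜 := ℂ) M‖

/-- `⟨ψ| M |ψ⟩`. -/
def braket {ι : Type*} [Fintype ι] (ψ : ι → ℂ) (M : Matrix ι ι ℂ) : ℂ :=
  star ψ ⬝ᵥ M.mulVec ψ

/-- Squared Euclidean norm of a complex vector. -/
def enormSq {ι : Type*} [Fintype ι] (ψ : ι → ℂ) : ℝ := ∑ i, Complex.normSq (ψ i)

/-- A family of psd matrices summing to the identity. -/
def IsPOVM {d : ℕ} {α : Type*} [Fintype α] (M : α → Mat d) : Prop :=
  (∀ a, (M a).PosSemidef) ∧ (∑ a, M a) = 1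

/-- A two-player one-round projection game. -/
structure ProjGame where
  U : Type
  V : Type
  A : Type
  B : Type
  [fU : Fintype U]
  [fV : Fintype V]
  [fA : Fintype A]
  [fB : Fintype B]
  [dA : DecidableEq A]
  μ : U → V → ℝ
  μ_nonneg : ∀ u v, 0 ≤ μ u v
  μ_sum : ∑ u, ∑ v, μ u v = 1
  proj : U → V → B → Option A

attribute [instance] ProjGame.fU ProjGame.fV ProjGame.fA ProjGame.fB ProjGame.dA

namespace ProjGame

variable (G : ProjGame)

/-- Marginal distribution on first-player questions. -/
def μL (u : G.U) : ℝ := ∑ v, G.μ u v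

/-- Marginal distribution on second-player questions. -/
def μR (v : G.V) : ℝ := ∑ u, G.μ u v

/-- Conditional distribution `μ(v|u)`. -/
def μc (u : G.U) (v : G.V) : ℝ := G.μ u v / G.μL u

/-- A `d`-dimensional quantum strategy for the first player. -/
def IsStrategyA {d : ℕ} (A : G.U → G.A → Mat d) : Prop := ∀ u, IsPOVM (A u)

/-- A `d`-dimensional quantum strategy for the second player. -/
def IsStrategyB {d : ℕ} (B : G.V → G.B → Mat d) : Prop := ∀ v, IsPOVM (B v)

/-- Success probability of a pair of quantum strategies with shared state `ψ`. -/
def pay {d : ℕ} (A : G.U → G.A → Mat d) (B : G.V → G.B → Mat d)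
    (ψ : Fin d × Fin d → ℂ) : ℝ :=
  ∑ u, ∑ v, G.μ u v * ∑ a, ∑ b,
    if G.proj u v b = some a then (braket ψ (mconj (A u a) ⊗ₖ B v b)).re else 0

/-- The entangled value `val*(G)`. -/
noncomputable def entVal : ℝ :=
  sSup { x | ∃ (d : ℕ) (A : G.U → G.A → Mat d) (B : G.V → G.B → Mat d)
    (ψ : Fin d × Fin d → ℂ),
    G.IsStrategyA A ∧ G.IsStrategyB B ∧ enormSq ψ = 1 ∧ x = G.pay A B ψ }

/-- The operator `B_u^a = Σ_v μ(v|u) Σ_{b → a} B_v^b`. -/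
def Bop {d : ℕ} (B : G.V → G.B → Mat d) (u : G.U) (a : G.A) : Mat d :=
  ∑ v, ∑ b, if G.proj u v b = some a then (G.μc u v : ℂ) • B v b else 0

/-- The matrix `Σ_u μ(u) Σ_a conj(B_u^a) ⊗ B_u^a`. -/
def sqMat {d : ℕ} (B : G.V → G.B → Mat d) :
    Matrix (Fin d × Fin d) (Fin d × Fin d) ℂ :=
  ∑ u, (G.μL u : ℂ) • ∑ a, mconj (G.Bop B u a) ⊗ₖ G.Bop B u a

/-- The square norm `‖G‖*`. -/
noncomputable def sqNorm : ℝ :=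
  sSup { x | ∃ (d : ℕ) (B : G.V → G.B → Mat d), G.IsStrategyB B ∧
    x = Real.sqrt (opNorm (G.sqMat B)) }

/-- A vector quantum strategy over the finite measured space `Fin n`. -/
def IsVecStrategy {n d : ℕ} (A : Fin n → G.V → G.B → Mat d) : Prop :=
  ∀ i v, (∀ b, (A i v b).PosSemidef) ∧ ((1 : Mat d) - ∑ b, A i v b).PosSemidef

/-- The matrix `E_ω conj(A_{ωv}) ⊗ A_{ωv}` at a fixed `v`. -/
def vecMatAt {n d : ℕ} (w : Fin n → ℝ) (A : Fin n → G.V → G.B → Mat d) (v : G.V) :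
    Matrix (Fin d × Fin d) (Fin d × Fin d) ℂ :=
  ∑ i, (w i : ℂ) • (mconj (∑ b, A i v b) ⊗ₖ (∑ b, A i v b))

/-- The matrix appearing in the definition of `val₊*`. -/
def vecMat {n d : ℕ} (w : Fin n → ℝ) (A : Fin n → G.V → G.B → Mat d) :
    Matrix (Fin d × Fin d) (Fin d × Fin d) ℂ :=
  ∑ i, (w i : ℂ) • ∑ u, (G.μL u : ℂ) • ∑ a, ∑ v, ∑ v',
    ((G.μc u v * G.μc u v' : ℝ) : ℂ) • ∑ b, ∑ b',
      if G.proj u v b = some a ∧ G.proj u v' b' = some a then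
        mconj (A i v b) ⊗ₖ A i v' b' else 0

/-- The relaxed value `val₊*(G)`. -/
noncomputable def valPlus : ℝ :=
  sSup { x | ∃ (n d : ℕ) (w : Fin n → ℝ) (A : Fin n → G.V → G.B → Mat d),
    (∀ i, 0 < w i) ∧ G.IsVecStrategy A ∧
    (∀ v, Real.sqrt (opNorm (G.vecMatAt w A v)) ≤ 1) ∧
    x = opNorm (G.vecMat w A) }

/-- The product of two projection games. -/
def prod (H : ProjGame) : ProjGame where
  U := G.U × H.U
  V := G.V × H.V
  A := G.A × H.A
  B := G.B × H.B
  fU := inferInstance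
  fV := inferInstance
  fA := inferInstance
  fB := inferInstance
  dA := inferInstance
  μ := fun p q => G.μ p.1 q.1 * H.μ p.2 q.2
  μ_nonneg := fun p q => mul_nonneg (G.μ_nonneg _ _) (H.μ_nonneg _ _)
  μ_sum := by
    have h1 := G.μ_sum
    have h2 := H.μ_sum
    calc ∑ p : G.U × H.U, ∑ q : G.V × H.V, G.μ p.1 q.1 * H.μ p.2 q.2
        = ∑ p : G.U × H.U, (∑ v, G.μ p.1 v) * (∑ v', H.μ p.2 v') := by
          refine Finset.sum_congr rfl fun p _ => ?_
          rw [Fintype.sum_prod_type, Finset.sum_mul_sum]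
      _ = (∑ u, ∑ v, G.μ u v) * (∑ u', ∑ v', H.μ u' v') := by
          rw [Fintype.sum_prod_type, Finset.sum_mul_sum]
      _ = 1 := by rw [h1, h2, one_mul]
  proj := fun p q b =>
    (G.proj p.1 q.1 b.1).bind fun a => (H.proj p.2 q.2 b.2).map fun a' => (a, a')

/-- The `k`-fold repetition `G^{⊗k}` (junk value `G` at `k = 0`). -/
def pow : ℕ → ProjGame
  | 0 => G
  | 1 => G
  | (n+2) => G.prod (pow (n+1))

/-- The normalized Laplacian of the square of the constraint graph of `G`. -/
def lap [DecidableEq G.V] : Matrix G.V G.V ℝ :=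
  1 - Matrix.of fun v v' =>
    (Real.sqrt (G.μR v))⁻¹ * (∑ u, G.μL u * G.μc u v * G.μc u v') * (Real.sqrt (G.μR v'))⁻¹

end ProjGame

namespace ProjGame

lemma trace_mul_re_nonneg {n : Type*} [Fintype n] [DecidableEq n] {M N : Matrix n n ℂ}
    (hM : M.PosSemidef) (hN : N.PosSemidef) : 0 ≤ (M * N).trace.re := by
  open scoped MatrixOrder Matrix.Norms.L2Operator in
  obtain ⟨Z, rfl⟩ := CStarAlgebra.nonneg_iff_eq_star_mul_self.mp hN.nonneg
  rw [star_eq_conjTranspose]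
  have h := (hM.mul_mul_conjTranspose_same Z).trace_nonneg
  rw [← Matrix.mul_assoc, Matrix.trace_mul_comm, ← Matrix.mul_assoc]
  exact (Complex.le_def.mp h).1

/-- The quadratic form `tr (P X P X)` decomposed as a bilinear form in `X`. -/
def sandwich {d : ℕ} (P X Y : Mat d) : ℝ := (P * X * P * Y).trace.re

variable {d : ℕ} {P X Y Z : Mat d}

lemma sandwich_comm : sandwich P X Y = sandwich P Y X := by
  simp only [sandwich]
  rw [Matrix.mul_assoc (P * X), Matrix.trace_mul_comm]
  simp only [Matrix.mul_assoc]

lemma sandwich_nonneg (hP : P.PosSemidef) (hX : X.PosSemidef) (hY : Y.PosSemidef) :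
    0 ≤ sandwich P X Y := by
  have h := hX.mul_mul_conjTranspose_same P
  rw [hP.isHermitian.eq] at h
  exact trace_mul_re_nonneg h hY

lemma sandwich_self_nonneg (hP : P.PosSemidef) (hX : X.IsHermitian) : 0 ≤ sandwich P X X := by
  have h := hP.mul_mul_conjTranspose_same X
  rw [hX.eq] at h
  have := trace_mul_re_nonneg hP h
  simpa only [sandwich, Matrix.mul_assoc] using this

lemma sandwich_sub_right : sandwich P X (Y - Z) = sandwich P X Y - sandwich P X Z := by
  simp [sandwich, Matrix.mul_sub]

lemma sandwich_sub_left : sandwich P (X - Y) Z = sandwich P X Z - sandwich P Y Z := by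
  simp [sandwich, Matrix.mul_sub, Matrix.sub_mul]

lemma sandwich_mono_right (hP : P.PosSemidef) (hX : X.PosSemidef) (h : (Z - Y).PosSemidef) :
    sandwich P X Y ≤ sandwich P X Z := by
  have := sandwich_nonneg hP hX h
  rw [sandwich_sub_right] at this
  linarith

lemma sandwich_self_mono (hP : P.PosSemidef) (hX : X.PosSemidef) (hY : Y.PosSemidef)
    (h : (Y - X).PosSemidef) : sandwich P X X ≤ sandwich P Y Y :=
  (sandwich_mono_right hP hX h).trans (by
    rw [sandwich_comm]; exact sandwich_mono_right hP hY h)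

lemma two_mul_sandwich_le (hP : P.PosSemidef) (hX : X.IsHermitian) (hY : Y.IsHermitian) :
    2 * sandwich P X Y ≤ sandwich P X X + sandwich P Y Y := by
  have := sandwich_self_nonneg hP (hX.sub hY)
  rw [sandwich_sub_right, sandwich_sub_left, sandwich_sub_left, sandwich_comm (X := Y)] at this
  linarith

lemma sandwich_one : sandwich P 1 1 = (P * P).trace.re := by simp [sandwich]

lemma mconj_eq_transpose (hX : X.IsHermitian) : mconj X = Xᵀ := by
  ext i j
  simpa [mconj] using congrFun (congrFun hX.eq j) i

lemma mconj_kronecker_mulVec_vec (hX : X.IsHermitian) (K : Mat d) :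
    (mconj X ⊗ₖ X) *ᵥ vec K = vec (X * K * X) := by
  rw [kronecker_mulVec_vec, mconj_eq_transpose hX, transpose_transpose]

lemma posSemidef_mconj_kronecker (hX : X.PosSemidef) : (mconj X ⊗ₖ X).PosSemidef := by
  rw [mconj_eq_transpose hX.isHermitian]
  exact hX.transpose.kronecker hX


open scoped MatrixOrder Matrix.Norms.L2Operator in
lemma opNorm_le_iff {n : Type*} [Fintype n] [DecidableEq n] {T : Matrix n n ℂ} {c : ℝ}
    (hT : T.PosSemidef) (hc : 0 ≤ c) :
    opNorm T ≤ c ↔ ∀ x : n → ℂ, (star x ⬝ᵥ (T *ᵥ x)).re ≤ c * (star x ⬝ᵥ x).re := by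
  rw [opNorm, l2_opNorm_toEuclideanCLM, CStarAlgebra.norm_le_iff_le_algebraMap T hc hT.nonneg,
    Matrix.le_iff]
  have hA : algebraMap ℝ (Matrix n n ℂ) c = (c : ℂ) • 1 := by
    rw [Algebra.algebraMap_eq_smul_one]; ext; simp
  have hH : ((c : ℂ) • (1 : Matrix n n ℂ) - T).IsHermitian := by
    refine IsHermitian.sub ?_ hT.isHermitian
    simp [IsHermitian, conjTranspose_smul]
  rw [hA, Matrix.posSemidef_iff_dotProduct_mulVec, and_iff_right hH]
  refine forall_congr' fun x => ?_
  have him := hH.im_star_dotProduct_mulVec_self x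
  rw [Complex.nonneg_iff, and_iff_left (by exact him.symm)]
  simp [sub_mulVec, dotProduct_sub, smul_mulVec]

/-- Every Hermitian matrix is a difference of positive semidefinite matrices with zero product. -/
lemma exists_posSemidef_sub {H : Mat d} (hH : H.IsHermitian) :
    ∃ P N : Mat d, P.PosSemidef ∧ N.PosSemidef ∧ P * N = 0 ∧ N * P = 0 ∧ H = P - N := by
  open scoped MatrixOrder Matrix.Norms.L2Operator in
  exact ⟨H⁺, H⁻, (CFC.posPart_nonneg H).posSemidef, (CFC.negPart_nonneg H).posSemidef,
    CFC.posPart_mul_negPart H, CFC.negPart_mul_posPart H, (CFC.posPart_sub_negPart H hH).symm⟩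

/-- `E_ω conj(X_ω) ⊗ X_ω`. -/
def sumKron {ι : Type*} [Fintype ι] (w : ι → ℝ) (X : ι → Mat d) :
    Matrix (Fin d × Fin d) (Fin d × Fin d) ℂ :=
  ∑ i, (w i : ℂ) • (mconj (X i) ⊗ₖ X i)

section
variable {ι : Type*} [Fintype ι] {w : ι → ℝ} {A : ι → Mat d}

lemma sumKron_posSemidef (hw : ∀ i, 0 ≤ w i) (hA : ∀ i, (A i).PosSemidef) :
    (sumKron w A).PosSemidef :=
  Matrix.posSemidef_sum _ fun i _ =>
    (posSemidef_mconj_kronecker (hA i)).smul (by exact_mod_cast hw i)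

lemma sumKron_form (hA : ∀ i, (A i).PosSemidef) (K : Mat d) :
    (star (vec K) ⬝ᵥ (sumKron w A *ᵥ vec K)).re = ∑ i, w i * (Kᴴ * A i * K * A i).trace.re := by
  simp [sumKron, sum_mulVec, smul_mulVec, mconj_kronecker_mulVec_vec (hA _).isHermitian,
    dotProduct_sum, star_vec_dotProduct_vec, Matrix.mul_assoc]

lemma sum_sandwich_le_opNorm (hw : ∀ i, 0 ≤ w i) (hA : ∀ i, (A i).PosSemidef)
    (hP : P.PosSemidef) :
    ∑ i, w i * sandwich P (A i) (A i) ≤ opNorm (sumKron w A) * (P * P).trace.re := by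
  have h := (opNorm_le_iff (sumKron_posSemidef hw hA) (norm_nonneg _)).1 le_rfl (vec P)
  rwa [sumKron_form hA, star_vec_dotProduct_vec, hP.isHermitian.eq] at h

/-- It suffices to test the operator norm of `sumKron` on positive semidefinite vectors. -/
lemma opNorm_sumKron_le (hw : ∀ i, 0 ≤ w i) (hA : ∀ i, (A i).PosSemidef) {c : ℝ} (hc : 0 ≤ c)
    (h : ∀ P : Mat d, P.PosSemidef →
      ∑ i, w i * sandwich P (A i) (A i) ≤ c * (P * P).trace.re) :
    opNorm (sumKron w A) ≤ c := by
  have herm : ∀ H : Mat d, H.IsHermitian →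
      ∑ i, w i * sandwich H (A i) (A i) ≤ c * (H * H).trace.re := by
    intro H hH
    obtain ⟨P, N, hP, hN, hPN, hNP, rfl⟩ := exists_posSemidef_sub hH
    have h1 := h (P + N) (hP.add hN)
    have h2 : ((P + N) * (P + N)).trace.re = ((P - N) * (P - N)).trace.re := by
      simp [Matrix.mul_add, Matrix.add_mul, Matrix.mul_sub, Matrix.sub_mul, hPN, hNP]
    rw [← h2]
    refine le_trans (Finset.sum_le_sum fun i _ => mul_le_mul_of_nonneg_left ?_ (hw i)) h1
    have key : ∀ Q R : Mat d, Q.PosSemidef → R.PosSemidef →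
        0 ≤ (Q * (A i * (R * A i))).trace.re := by
      intro Q R hQ hR
      have := hR.mul_mul_conjTranspose_same (A i)
      rw [(hA i).isHermitian.eq] at this
      simpa only [Matrix.mul_assoc] using trace_mul_re_nonneg hQ this
    have k1 := key P N hP hN
    have k2 := key N P hN hP
    simp only [sandwich, Matrix.mul_add, Matrix.add_mul, Matrix.mul_sub, Matrix.sub_mul,
      Matrix.mul_assoc, trace_add, trace_sub, Complex.add_re, Complex.sub_re]
    linarith
  rw [opNorm_le_iff (sumKron_posSemidef hw hA) hc]
  intro x
  obtain ⟨K, rfl⟩ := vec_bijective.surjective x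
  rw [sumKron_form hA, star_vec_dotProduct_vec]
  obtain ⟨R, S, hR, hS, rfl⟩ : ∃ R S : Mat d, R.IsHermitian ∧ S.IsHermitian ∧
      K = R + Complex.I • S :=
    ⟨realPart K, imaginaryPart K, (realPart K).2, (imaginaryPart K).2,
      (realPart_add_I_smul_imaginaryPart K).symm⟩
  have h1 := add_le_add (herm R hR) (herm S hS)
  rw [← Finset.sum_add_distrib] at h1
  have hconj : (R + Complex.I • S)ᴴ = R - Complex.I • S := by
    simp [conjTranspose_add, conjTranspose_smul, hR.eq, hS.eq, sub_eq_add_neg]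
  have cross : ∀ M : Mat d, ((R - Complex.I • S) * M * (R + Complex.I • S) * M).trace.re
      = (R * M * R * M).trace.re + (S * M * S * M).trace.re := by
    intro M
    have hc : (R * (M * (S * M))).trace = (S * (M * (R * M))).trace := by
      rw [← Matrix.mul_assoc, Matrix.trace_mul_comm]
      simp only [Matrix.mul_assoc]
    simp [Matrix.mul_add, Matrix.add_mul, Matrix.sub_mul, Matrix.mul_assoc, hc]
  calc _ = ∑ i, (w i * sandwich R (A i) (A i) + w i * sandwich S (A i) (A i)) :=
        Finset.sum_congr rfl fun i _ => by rw [hconj, cross, sandwich, sandwich, mul_add]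
    _ ≤ _ := h1
    _ = _ := by
        have := cross 1
        simp only [Matrix.mul_one] at this
        rw [hconj, this, mul_add]

end

lemma sandwich_sum_left {ι : Type*} (s : Finset ι) (f : ι → Mat d) :
    sandwich P (∑ i ∈ s, f i) Y = ∑ i ∈ s, sandwich P (f i) Y := by
  simp [sandwich, Matrix.mul_sum, Matrix.sum_mul]

lemma sandwich_sum_self_le {ι : Type*} [Fintype ι] (hP : P.PosSemidef) {f : ι → Mat d}
    (hf : ∀ i, (f i).IsHermitian) :
    sandwich P (∑ i, f i) (∑ i, f i) ≤ Fintype.card ι * ∑ i, sandwich P (f i) (f i) := by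
  have h : ∀ i, sandwich P (f i) (∑ j, f j) = ∑ j, sandwich P (f i) (f j) := fun i => by
    rw [sandwich_comm, sandwich_sum_left]
    exact Finset.sum_congr rfl fun j _ => sandwich_comm
  rw [sandwich_sum_left]
  simp only [h]
  have h2 : ∑ i, ∑ j, sandwich P (f i) (f j)
      ≤ ∑ i, ∑ j, (sandwich P (f i) (f i) + sandwich P (f j) (f j)) / 2 :=
    Finset.sum_le_sum fun i _ => Finset.sum_le_sum fun j _ => by
      linarith [two_mul_sandwich_le hP (hf i) (hf j)]
  refine h2.trans (le_of_eq ?_)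
  simp only [← Finset.sum_div, Finset.sum_add_distrib, Finset.sum_const, Finset.card_univ,
    nsmul_eq_mul, ← Finset.mul_sum]
  ring

variable (G : ProjGame)

lemma μL_nonneg (u : G.U) : 0 ≤ G.μL u := Finset.sum_nonneg fun v _ => G.μ_nonneg u v

lemma μc_nonneg (u : G.U) (v : G.V) : 0 ≤ G.μc u v := div_nonneg (G.μ_nonneg u v) (G.μL_nonneg u)

lemma sum_μc_le_one (u : G.U) : ∑ v, G.μc u v ≤ 1 := by
  simp only [μc, ← Finset.sum_div]
  exact div_self_le_one _

lemma μc_le_one (u : G.U) (v : G.V) : G.μc u v ≤ 1 :=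
  (Finset.single_le_sum (fun v _ => G.μc_nonneg u v) (Finset.mem_univ v)).trans (G.sum_μc_le_one u)

lemma Bop_posSemidef {B : G.V → G.B → Mat d} (hB : ∀ v b, (B v b).PosSemidef) (u : G.U) (a : G.A) :
    (G.Bop B u a).PosSemidef := by
  refine Matrix.posSemidef_sum _ fun v _ => Matrix.posSemidef_sum _ fun b _ => ?_
  split_ifs
  · exact (hB v b).smul (by exact_mod_cast G.μc_nonneg u v)
  · exact .zero

lemma sum_smul_sub_Bop_posSemidef {B : G.V → G.B → Mat d} (hB : ∀ v b, (B v b).PosSemidef)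
    (u : G.U) (a : G.A) :
    (∑ v, (G.μc u v : ℂ) • ∑ b, B v b - G.Bop B u a).PosSemidef := by
  simp only [Bop, Finset.smul_sum, ← Finset.sum_sub_distrib]
  refine Matrix.posSemidef_sum _ fun v _ => Matrix.posSemidef_sum _ fun b _ => ?_
  split_ifs
  · rw [sub_self]; exact .zero
  · rw [sub_zero]; exact (hB v b).smul (by exact_mod_cast G.μc_nonneg u v)

lemma sum_sub_Bop_posSemidef {B : G.V → G.B → Mat d} (hB : ∀ v b, (B v b).PosSemidef)
    (u : G.U) (a : G.A) : (∑ v, ∑ b, B v b - G.Bop B u a).PosSemidef := by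
  have h : (∑ v, (1 - (G.μc u v : ℂ)) • ∑ b, B v b).PosSemidef :=
    Matrix.posSemidef_sum _ fun v _ =>
      (Matrix.posSemidef_sum _ fun b _ => hB v b).smul
        (by rw [sub_nonneg]; exact_mod_cast G.μc_le_one u v)
  convert h.add (G.sum_smul_sub_Bop_posSemidef hB u a) using 1
  simp [sub_smul, Finset.sum_sub_distrib]

lemma one_sub_Bop_posSemidef {B : G.V → G.B → Mat d} (hB : G.IsStrategyB B)
    (u : G.U) (a : G.A) : (1 - G.Bop B u a).PosSemidef := by
  have h1 : ((1 - ∑ v, G.μc u v : ℂ) • (1 : Mat d)).PosSemidef :=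
    Matrix.PosSemidef.one.smul (by rw [sub_nonneg]; exact_mod_cast G.sum_μc_le_one u)
  convert h1.add (G.sum_smul_sub_Bop_posSemidef (fun v => (hB v).1) u a) using 1
  simp only [(hB _).2, ← Finset.sum_smul]
  simp [sub_smul]

lemma Bop_eq_zero {B : G.V → G.B → Mat d} {u : G.U} (hu : G.μL u = 0) (a : G.A) :
    G.Bop B u a = 0 := by
  simp [Bop, μc, hu]

lemma sum_Bop {ι : Type*} [Fintype ι] (B : ι → G.V → G.B → Mat d) (u : G.U) (a : G.A) :
    ∑ i, G.Bop (B i) u a = G.Bop (fun v b => ∑ i, B i v b) u a := by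
  simp only [Bop]
  rw [Finset.sum_comm]
  refine Finset.sum_congr rfl fun v _ => ?_
  rw [Finset.sum_comm]
  refine Finset.sum_congr rfl fun b _ => ?_
  split_ifs <;> simp [Finset.smul_sum]

lemma sqMat_eq_sumKron (B : G.V → G.B → Mat d) :
    G.sqMat B = sumKron (fun p : G.U × G.A => G.μL p.1) fun p => G.Bop B p.1 p.2 := by
  simp [sqMat, sumKron, Fintype.sum_prod_type, Finset.smul_sum]

lemma mconj_Bop_kronecker_Bop (B : G.V → G.B → Mat d) (u : G.U) (a : G.A) :
    mconj (G.Bop B u a) ⊗ₖ G.Bop B u a = ∑ v, ∑ v', ((G.μc u v * G.μc u v' : ℝ) : ℂ) •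
      ∑ b, ∑ b', if G.proj u v b = some a ∧ G.proj u v' b' = some a then
        mconj (B v b) ⊗ₖ B v' b' else 0 := by
  have hL : ∀ f : G.V → G.B → Mat d, mconj (∑ v, ∑ b, f v b) = ∑ v, ∑ b, mconj (f v b) := by
    intro f
    ext i j
    simp [mconj, Matrix.sum_apply]
  have hK : ∀ f g : G.V → G.B → Mat d, (∑ v, ∑ b, f v b) ⊗ₖ (∑ v, ∑ b, g v b)
      = ∑ v, ∑ v', ∑ b, ∑ b', f v b ⊗ₖ g v' b' := by
    intro f g
    ext i j
    simp only [kroneckerMap_apply, Matrix.sum_apply, Finset.sum_mul_sum]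
  rw [Bop, hL, hK]
  simp only [Finset.smul_sum]
  refine Finset.sum_congr rfl fun v _ => Finset.sum_congr rfl fun v' _ =>
    Finset.sum_congr rfl fun b _ => Finset.sum_congr rfl fun b' _ => ?_
  ext i j
  by_cases h : G.proj u v b = some a <;> by_cases h' : G.proj u v' b' = some a <;>
    simp [h, h', mconj]
  ring

lemma vecMat_eq {n : ℕ} (w : Fin n → ℝ) (A : Fin n → G.V → G.B → Mat d) :
    G.vecMat w A = ∑ i, (w i : ℂ) • G.sqMat (A i) := by
  simp only [vecMat, sqMat, mconj_Bop_kronecker_Bop]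

lemma sum_smul_sqMat_eq_sumKron {Ω : Type*} [Fintype Ω] (w : Ω → ℝ)
    (A : Ω → G.V → G.B → Mat d) :
    ∑ i, (w i : ℂ) • G.sqMat (A i) = sumKron (fun p : Ω × G.U × G.A => w p.1 * G.μL p.2.1)
      fun p => G.Bop (A p.1) p.2.1 p.2.2 := by
  simp only [sqMat, sumKron, Fintype.sum_prod_type, Finset.smul_sum, smul_smul,
    Complex.ofReal_mul]

lemma opNorm_sqMat_le_sum {B : G.V → G.B → Mat d} (hB : G.IsStrategyB B) :
    opNorm (G.sqMat B) ≤ ∑ p : G.U × G.A, G.μL p.1 := by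
  have hpsd : ∀ u a, (G.Bop B u a).PosSemidef := G.Bop_posSemidef fun v => (hB v).1
  have hc : 0 ≤ ∑ p : G.U × G.A, G.μL p.1 := Finset.sum_nonneg fun p _ => G.μL_nonneg p.1
  have hle : ∀ P : Mat d, P.PosSemidef → ∑ p : G.U × G.A, G.μL p.1 *
      sandwich P (G.Bop B p.1 p.2) (G.Bop B p.1 p.2)
        ≤ (∑ p : G.U × G.A, G.μL p.1) * (P * P).trace.re := fun P hP => by
    rw [Finset.sum_mul]
    exact Finset.sum_le_sum fun p _ => mul_le_mul_of_nonneg_left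
      ((sandwich_self_mono hP (hpsd p.1 p.2) Matrix.PosSemidef.one
        (G.one_sub_Bop_posSemidef hB p.1 p.2)).trans_eq sandwich_one) (G.μL_nonneg p.1)
  rw [sqMat_eq_sumKron]
  exact opNorm_sumKron_le (w := fun p : G.U × G.A => G.μL p.1) (A := fun p => G.Bop B p.1 p.2)
    (fun p => G.μL_nonneg p.1) (fun p => hpsd p.1 p.2) hc hle

lemma bddAbove_sqNorm : BddAbove { x | ∃ (d : ℕ) (B : G.V → G.B → Mat d), G.IsStrategyB B ∧
    x = Real.sqrt (opNorm (G.sqMat B)) } := by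
  refine ⟨Real.sqrt (∑ p : G.U × G.A, G.μL p.1), ?_⟩
  rintro x ⟨d, B, hB, hx⟩
  rw [hx]
  exact Real.sqrt_le_sqrt (G.opNorm_sqMat_le_sum hB)

lemma opNorm_sqMat_le {B : G.V → G.B → Mat d} (hB : G.IsStrategyB B) :
    opNorm (G.sqMat B) ≤ G.sqNorm ^ 2 :=
  (Real.sqrt_le_iff.1 (le_csSup G.bddAbove_sqNorm ⟨d, B, hB, rfl⟩)).2

lemma bddAbove_valPlus : BddAbove { x | ∃ (n d : ℕ) (w : Fin n → ℝ)
    (A : Fin n → G.V → G.B → Mat d), (∀ i, 0 < w i) ∧ G.IsVecStrategy A ∧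
    (∀ v, Real.sqrt (opNorm (G.vecMatAt w A v)) ≤ 1) ∧ x = opNorm (G.vecMat w A) } := by
  have hc : 0 ≤ ∑ p : G.U × G.A, G.μL p.1 := Finset.sum_nonneg fun p _ => G.μL_nonneg p.1
  refine ⟨(∑ p : G.U × G.A, G.μL p.1) * (Fintype.card G.V * Fintype.card G.V), ?_⟩
  rintro _ ⟨n, d, w, A, hw, hA, hn, rfl⟩
  have hpsd := fun i => G.Bop_posSemidef fun v => (hA i v).1
  have hS : ∀ i v, (∑ b, A i v b).PosSemidef := fun i v =>
    Matrix.posSemidef_sum _ fun b _ => (hA i v).1 b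
  rw [vecMat_eq, sum_smul_sqMat_eq_sumKron]
  refine opNorm_sumKron_le (fun p => mul_nonneg (hw _).le (G.μL_nonneg _)) (fun p => hpsd _ _ _)
    (by positivity) fun P hP => ?_
  have hPP : 0 ≤ (P * P).trace.re := trace_mul_re_nonneg hP hP
  have hv : ∀ v, ∑ i, w i * sandwich P (∑ b, A i v b) (∑ b, A i v b) ≤ (P * P).trace.re := by
    intro v
    refine (sum_sandwich_le_opNorm (fun i => (hw i).le) (fun i => hS i v) hP).trans ?_
    exact mul_le_of_le_one_left hPP (Real.sqrt_le_one.1 (hn v))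
  calc _ ≤ ∑ p : Fin n × G.U × G.A, w p.1 * G.μL p.2.1 *
          (Fintype.card G.V * ∑ v, sandwich P (∑ b, A p.1 v b) (∑ b, A p.1 v b)) := by
        refine Finset.sum_le_sum fun p _ => mul_le_mul_of_nonneg_left ?_
          (mul_nonneg (hw _).le (G.μL_nonneg _))
        refine (sandwich_self_mono hP (hpsd _ _ _) (Matrix.posSemidef_sum _ fun v _ => hS p.1 v)
          (G.sum_sub_Bop_posSemidef (fun v => (hA p.1 v).1) _ _)).trans ?_
        exact sandwich_sum_self_le hP fun v => (hS p.1 v).isHermitian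
    _ = (∑ p : G.U × G.A, G.μL p.1) * Fintype.card G.V *
          ∑ v, ∑ i, w i * sandwich P (∑ b, A i v b) (∑ b, A i v b) := by
        rw [Finset.sum_comm, Fintype.sum_prod_type, Finset.mul_sum]
        refine Finset.sum_congr rfl fun i _ => ?_
        rw [← Finset.mul_sum, Finset.sum_mul, Finset.sum_mul]
        exact Finset.sum_congr rfl fun p _ => by ring
    _ ≤ (∑ p : G.U × G.A, G.μL p.1) * Fintype.card G.V *
          ∑ _v : G.V, (P * P).trace.re := by
        gcongr with v _
        exact hv v
    _ = _ := by
        rw [Finset.sum_const, Finset.card_univ, nsmul_eq_mul]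
        ring

lemma opNorm_sum_smul_sqMat_le_valPlus {Ω : Type*} [Fintype Ω] {w : Ω → ℝ} (hw : ∀ i, 0 < w i)
    {A : Ω → G.V → G.B → Mat d}
    (hA : ∀ i v, (∀ b, (A i v b).PosSemidef) ∧ (1 - ∑ b, A i v b).PosSemidef)
    (h : ∀ v, opNorm (sumKron w fun i => ∑ b, A i v b) ≤ 1) :
    opNorm (∑ i, (w i : ℂ) • G.sqMat (A i)) ≤ G.valPlus := by
  let e := (Fintype.equivFin Ω).symm
  refine le_csSup G.bddAbove_valPlus ⟨_, d, fun i => w (e i), fun i => A (e i),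
    fun i => hw _, fun i => hA _, fun v => ?_, ?_⟩
  · rw [Real.sqrt_le_one]
    convert h v using 2
    exact e.sum_comp fun i => (w i : ℂ) • (mconj (∑ b, A i v b) ⊗ₖ (∑ b, A i v b))
  · rw [vecMat_eq]
    congr 1
    exact (e.sum_comp fun i => (w i : ℂ) • G.sqMat (A i)).symm

variable (H : ProjGame)

lemma μL_prod (p : G.U × H.U) : (G.prod H).μL p = G.μL p.1 * H.μL p.2 := by
  simp only [μL, Finset.sum_mul_sum]
  exact Fintype.sum_prod_type _

lemma μc_prod (p : G.U × H.U) (q : G.V × H.V) :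
    (G.prod H).μc p q = G.μc p.1 q.1 * H.μc p.2 q.2 := by
  exact (congrArg (fun r => G.μ p.1 q.1 * H.μ p.2 q.2 / r) (μL_prod G H p)).trans
    (div_mul_div_comm _ _ _ _).symm

lemma prod_proj_eq_some (p : G.U × H.U) (q : G.V × H.V) (b : G.B × H.B) (a : G.A × H.A) :
    (G.prod H).proj p q b = some a ↔
      G.proj p.1 q.1 b.1 = some a.1 ∧ H.proj p.2 q.2 b.2 = some a.2 := by
  obtain ⟨a, a'⟩ := a
  simp [prod, Option.bind_eq_some_iff]

lemma Bop_prod (C : G.V × H.V → G.B × H.B → Mat d) (p : G.U × H.U) (a : G.A × H.A) :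
    (G.prod H).Bop C p a =
      G.Bop (fun v b => H.Bop (fun v' b' => C (v, v') (b, b')) p.2 a.2) p.1 a.1 := by
  have h1 : (G.prod H).Bop C p a = ∑ q : G.V × H.V, ∑ b : G.B × H.B,
      if G.proj p.1 q.1 b.1 = some a.1 ∧ H.proj p.2 q.2 b.2 = some a.2 then
        ((G.μc p.1 q.1 * H.μc p.2 q.2 : ℝ) : ℂ) • C q b else 0 := by
    refine Finset.sum_congr rfl fun q _ => Finset.sum_congr rfl fun b _ => ?_
    by_cases h : (G.prod H).proj p q b = some a
    · rw [if_pos ((prod_proj_eq_some G H p q b a).1 h)]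
      exact (if_pos h).trans (congrArg (fun r : ℝ => (r : ℂ) • C q b) (μc_prod G H p q))
    · rw [if_neg (mt (prod_proj_eq_some G H p q b a).2 h)]
      exact if_neg h
  rw [h1]
  simp only [Bop, Fintype.sum_prod_type]
  refine Finset.sum_congr rfl fun v _ => ?_
  rw [Finset.sum_comm]
  refine Finset.sum_congr rfl fun b _ => ?_
  by_cases h : G.proj p.1 v b = some a.1
  · simp only [h, true_and, if_true, Finset.smul_sum]
    refine Finset.sum_congr rfl fun v' _ => Finset.sum_congr rfl fun b' _ => ?_
    split_ifs
    · rw [smul_smul, Complex.ofReal_mul]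
    · rw [smul_zero]
  · simp [h]

lemma sqMat_prod (C : G.V × H.V → G.B × H.B → Mat d) :
    (G.prod H).sqMat C = ∑ ω : H.U × H.A, (H.μL ω.1 : ℂ) •
      G.sqMat fun v b => H.Bop (fun v' b' => C (v, v') (b, b')) ω.1 ω.2 := by
  have h1 : (G.prod H).sqMat C = ∑ u : G.U, ∑ u' : H.U, ∑ a : G.A, ∑ a' : H.A,
      ((G.μL u * H.μL u' : ℝ) : ℂ) •
        (mconj (G.Bop (fun v b => H.Bop (fun v' b' => C (v, v') (b, b')) u' a') u a) ⊗ₖ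
          G.Bop (fun v b => H.Bop (fun v' b' => C (v, v') (b, b')) u' a') u a) := by
    simp only [sqMat, Finset.smul_sum]
    refine (Fintype.sum_prod_type _).trans ?_
    refine Finset.sum_congr rfl fun u _ => Finset.sum_congr rfl fun u' _ =>
      (Fintype.sum_prod_type _).trans ?_
    refine Finset.sum_congr rfl fun a _ => Finset.sum_congr rfl fun a' _ => ?_
    rw [← Bop_prod G H C (u, u') (a, a')]
    exact congrArg (fun r : ℝ => (r : ℂ) • _) (μL_prod G H (u, u'))
  rw [h1, Finset.sum_comm, Fintype.sum_prod_type]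
  refine Finset.sum_congr rfl fun u' _ => ?_
  simp only [sqMat, Finset.smul_sum, smul_smul]
  rw [Finset.sum_comm (s := (Finset.univ : Finset H.A))]
  refine Finset.sum_congr rfl fun u _ => ?_
  rw [Finset.sum_comm]
  refine Finset.sum_congr rfl fun a' _ => Finset.sum_congr rfl fun a _ => ?_
  rw [mul_comm, Complex.ofReal_mul]

lemma opNorm_smul {n : Type*} [Fintype n] [DecidableEq n] {t : ℝ} (ht : 0 ≤ t)
    (T : Matrix n n ℂ) : opNorm ((t : ℂ) • T) = t * opNorm T := by
  rw [opNorm, map_smul, norm_smul, Complex.norm_real, Real.norm_of_nonneg ht, opNorm]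

lemma mul_opNorm_sqMat_prod_le {C : G.V × H.V → G.B × H.B → Mat d}
    (hC : (G.prod H).IsStrategyB C) {t : ℝ} (ht : 0 < t) (htH : t * H.sqNorm ^ 2 ≤ 1) :
    t * opNorm ((G.prod H).sqMat C) ≤ G.valPlus := by
  let w : H.U × H.A → ℝ := fun ω => t * if H.μL ω.1 = 0 then 1 else H.μL ω.1
  let A : H.U × H.A → G.V → G.B → Mat d := fun ω v b =>
    H.Bop (fun v' b' => C (v, v') (b, b')) ω.1 ω.2
  have hw : ∀ ω, 0 < w ω := fun ω => by
    refine mul_pos ht ?_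
    split_ifs with h
    · exact one_pos
    · exact lt_of_le_of_ne (H.μL_nonneg _) (Ne.symm h)
  have hstr : ∀ v, H.IsStrategyB fun v' b' => ∑ b, C (v, v') (b, b') := fun v v' =>
    ⟨fun b' => Matrix.posSemidef_sum _ fun b _ => (hC (v, v')).1 (b, b'), by
      rw [Finset.sum_comm]
      exact (Fintype.sum_prod_type _).symm.trans (hC (v, v')).2⟩
  have hsum : ∀ ω v, ∑ b, A ω v b = H.Bop (fun v' b' => ∑ b, C (v, v') (b, b')) ω.1 ω.2 :=
    fun ω v => H.sum_Bop (fun b v' b' => C (v, v') (b, b')) ω.1 ω.2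
  rw [← opNorm_smul ht.le]
  have heq : (t : ℂ) • (G.prod H).sqMat C = ∑ ω, (w ω : ℂ) • G.sqMat (A ω) := by
    rw [sqMat_prod, Finset.smul_sum]
    refine Finset.sum_congr rfl fun ω _ => ?_
    by_cases h : H.μL ω.1 = 0
    · have hA : A ω = fun _ _ => 0 := by
        funext v b
        exact H.Bop_eq_zero h ω.2
      have h0 : G.sqMat (fun _ _ => (0 : Mat d)) = 0 := by
        simp [sqMat, Bop]
      rw [hA, h0, h]
      simp
    · simp only [w, if_neg h, smul_smul, Complex.ofReal_mul]
      rfl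
  rw [heq]
  refine G.opNorm_sum_smul_sqMat_le_valPlus hw (fun ω v => ⟨fun b => ?_, ?_⟩) fun v => ?_
  · exact H.Bop_posSemidef (fun v' b' => (hC (v, v')).1 (b, b')) _ _
  · rw [hsum]
    exact H.one_sub_Bop_posSemidef (hstr v) _ _
  · have hk : sumKron w (fun ω => ∑ b, A ω v b)
        = (t : ℂ) • H.sqMat fun v' b' => ∑ b, C (v, v') (b, b') := by
      rw [sqMat_eq_sumKron, sumKron, sumKron, Finset.smul_sum]
      refine Finset.sum_congr rfl fun ω _ => ?_
      rw [hsum]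
      by_cases h : H.μL ω.1 = 0
      · simp [H.Bop_eq_zero h]
      · simp only [w, if_neg h, smul_smul, Complex.ofReal_mul]
    rw [hk, opNorm_smul ht.le]
    exact (mul_le_mul_of_nonneg_left (H.opNorm_sqMat_le (hstr v)) ht.le).trans htH

end ProjGame

/-- For any two projection games `G` and `H`, `‖G⊗H‖*² ≤ val₊*(G)·‖H‖*²`. -/
theorem sqNorm_prod_sq_le (G H : ProjGame) :
    (G.prod H).sqNorm ^ 2 ≤ G.valPlus * H.sqNorm ^ 2 := by
  have hv : 0 ≤ G.valPlus := Real.sSup_nonneg (by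
    rintro _ ⟨n, d, w, A, -, -, -, rfl⟩
    exact norm_nonneg _)
  have hH : 0 ≤ H.sqNorm ^ 2 := sq_nonneg _
  have key : ∀ (d : ℕ) (C : (G.prod H).V → (G.prod H).B → Mat d), (G.prod H).IsStrategyB C →
      opNorm ((G.prod H).sqMat C) ≤ G.valPlus * H.sqNorm ^ 2 := by
    intro d C hC
    have hε : ∀ ε > 0, opNorm ((G.prod H).sqMat C) ≤ G.valPlus * (H.sqNorm ^ 2 + ε) := by
      intro ε hε
      have hpos : 0 < H.sqNorm ^ 2 + ε := by positivity
      have := G.mul_opNorm_sqMat_prod_le H hC (inv_pos.2 hpos) (by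
        rw [inv_mul_le_iff₀ hpos]
        linarith)
      rwa [inv_mul_le_iff₀ hpos, mul_comm] at this
    have hlim : Filter.Tendsto (fun ε : ℝ => G.valPlus * (H.sqNorm ^ 2 + ε))
        (nhdsWithin 0 (Set.Ioi 0)) (nhds (G.valPlus * (H.sqNorm ^ 2 + 0))) :=
      (Continuous.tendsto (by fun_prop) 0).mono_left nhdsWithin_le_nhds
    rw [add_zero] at hlim
    exact ge_of_tendsto hlim (Filter.eventually_of_mem self_mem_nhdsWithin hε)
  have hle : (G.prod H).sqNorm ≤ Real.sqrt (G.valPlus * H.sqNorm ^ 2) := by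
    refine Real.sSup_le ?_ (Real.sqrt_nonneg _)
    rintro _ ⟨d, C, hC, rfl⟩
    exact Real.sqrt_le_sqrt (key d C hC)
  have h0 : 0 ≤ (G.prod H).sqNorm := Real.sSup_nonneg (by
    rintro _ ⟨d, C, -, rfl⟩
    exact Real.sqrt_nonneg _)
  exact (Real.le_sqrt h0 (mul_nonneg hv hH)).1 hle
end
end

section
/- For any integers d, d' ≥ 1 and any finite families of matrices A_i ∈ M_d(ℂ), B_i ∈ M_{d'}(ℂ) (i = 1,…,n): ‖Σ_i conj(A_i) ⊗ B_i‖² ≤ ‖Σ_i conj(A_i) ⊗ A_i‖ · ‖Σ_i conj(B_i) ⊗ B_i‖, where conj denotes entrywise complex conjugation, ⊗ the Kronecker product, and ‖·‖ the operator (spectral) norm. -/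
noncomputable section
open scoped Kronecker ComplexOrder
open Matrix

open scoped MatrixOrder Matrix.Norms.L2Operator in
theorem exists_conjTranspose_mul_self_of_nonneg {m : Type*} [Fintype m] [DecidableEq m]
    {P : Matrix m m ℂ} (hP : 0 ≤ P) : ∃ G : Matrix m m ℂ, Gᴴ * G = P := by
  refine ⟨CFC.sqrt P, ?_⟩
  have hs : (CFC.sqrt P)ᴴ = CFC.sqrt P := (CFC.sqrt_nonneg P).isSelfAdjoint
  rw [hs, CFC.sqrt_mul_sqrt_self P hP]

open scoped MatrixOrder Matrix.Norms.L2Operator in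
/-- Every rectangular matrix `X` factors as `G₁ᴴ * G₂` with `G₁ᴴ * G₁ = |Xᴴ|` and
`G₂ᴴ * G₂ = |X|`. -/
theorem exists_balanced_factorization {m n : Type*} [Fintype m] [DecidableEq m]
    [Fintype n] [DecidableEq n] (X : Matrix m n ℂ) :
    ∃ (G₁ : Matrix (m ⊕ n) m ℂ) (G₂ : Matrix (m ⊕ n) n ℂ), G₁ᴴ * G₂ = X ∧
      (G₁ᴴ * G₁) * (G₁ᴴ * G₁) = X * Xᴴ ∧ (G₂ᴴ * G₂) * (G₂ᴴ * G₂) = Xᴴ * X := by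
  set P := CFC.sqrt (X * Xᴴ)
  set Q := CFC.sqrt (Xᴴ * X)
  have hP : 0 ≤ P := CFC.sqrt_nonneg _
  have hQ : 0 ≤ Q := CFC.sqrt_nonneg _
  have hPP : P * P = X * Xᴴ := CFC.sqrt_mul_sqrt_self _
    (nonneg_iff_posSemidef.2 (posSemidef_self_mul_conjTranspose X))
  have hQQ : Q * Q = Xᴴ * X := CFC.sqrt_mul_sqrt_self _
    (nonneg_iff_posSemidef.2 (posSemidef_conjTranspose_mul_self X))
  set D := fromBlocks P 0 0 Q with hD
  set M := fromBlocks 0 X Xᴴ 0 with hM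
  have hD0 : 0 ≤ D := by
    obtain ⟨p, hp⟩ := exists_conjTranspose_mul_self_of_nonneg hP
    obtain ⟨q, hq⟩ := exists_conjTranspose_mul_self_of_nonneg hQ
    have : D = (fromBlocks p 0 0 q)ᴴ * fromBlocks p 0 0 q := by
      simp [hD, fromBlocks_conjTranspose, fromBlocks_multiply, hp, hq]
    rw [this]
    exact nonneg_iff_posSemidef.2 (posSemidef_conjTranspose_mul_self _)
  have hMs : star M = M := by
    simp [hM, star_eq_conjTranspose, fromBlocks_conjTranspose]
  have hDM : star D * D = star M * M := by
    rw [hMs, hD0.isSelfAdjoint.star_eq]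
    simp [hD, hM, fromBlocks_multiply, hPP, hQQ]
  have habs : CFC.abs M = D := by
    rw [← CFC.abs_of_nonneg D hD0, CFC.abs, CFC.abs, hDM]
  have hsum : 0 ≤ D + M := by
    rw [← habs, CFC.abs_add_self M hMs]
    exact nsmul_nonneg (CFC.posPart_nonneg M) 2
  obtain ⟨G, hG⟩ := exists_conjTranspose_mul_self_of_nonneg hsum
  have hblock : Gᴴ * G = fromBlocks P X Xᴴ Q := by
    rw [hG, hD, hM, fromBlocks_add]; simp
  have h₁₁ : G.toCols₁ᴴ * G.toCols₁ = P := congrArg toBlocks₁₁ hblock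
  have h₁₂ : G.toCols₁ᴴ * G.toCols₂ = X := congrArg toBlocks₁₂ hblock
  have h₂₂ : G.toCols₂ᴴ * G.toCols₂ = Q := congrArg toBlocks₂₂ hblock
  exact ⟨G.toCols₁, G.toCols₂, h₁₂, by rw [h₁₁, hPP], by rw [h₂₂, hQQ]⟩

theorem norm_toLp_vec_sq {m n : Type*} [Fintype m] [Fintype n] (X : Matrix m n ℂ) :
    ‖WithLp.toLp 2 X.vec‖ ^ 2 = (Xᴴ * X).trace.re := by
  rw [← star_vec_dotProduct_vec, dotProduct_comm, ← EuclideanSpace.inner_toLp_toLp,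
    inner_self_eq_norm_sq_to_K]
  norm_cast

theorem norm_toLp_vec_eq_of_mul_self {m n k : Type*} [Fintype m] [Fintype n] [Fintype k]
    {G : Matrix k m ℂ} {X : Matrix n m ℂ} (h : (Gᴴ * G) * (Gᴴ * G) = Xᴴ * X) :
    ‖WithLp.toLp 2 (Gᴴ * G).vec‖ = ‖WithLp.toLp 2 X.vec‖ := by
  rw [← sq_eq_sq₀ (norm_nonneg _) (norm_nonneg _), norm_toLp_vec_sq, norm_toLp_vec_sq, ← h,
    (isHermitian_conjTranspose_mul_self G).eq]

theorem norm_toLp_vec_conjTranspose {m n : Type*} [Fintype m] [Fintype n] (X : Matrix m n ℂ) :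
    ‖WithLp.toLp 2 Xᴴ.vec‖ = ‖WithLp.toLp 2 X.vec‖ := by
  rw [← sq_eq_sq₀ (norm_nonneg _) (norm_nonneg _), norm_toLp_vec_sq, norm_toLp_vec_sq,
    trace_mul_comm, conjTranspose_conjTranspose]

theorem norm_star_dotProduct_mulVec_le {ι : Type*} [Fintype ι] [DecidableEq ι]
    (M : Matrix ι ι ℂ) (x y : ι → ℂ) :
    ‖star y ⬝ᵥ M *ᵥ x‖ ≤ opNorm M * (‖WithLp.toLp 2 x‖ * ‖WithLp.toLp 2 y‖) := by
  have h := (norm_inner_le_norm (𝕜 := ℂ) (WithLp.toLp 2 y)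
    (toEuclideanCLM (𝕜 := ℂ) M (WithLp.toLp 2 x))).trans
    (mul_le_mul_of_nonneg_left ((toEuclideanCLM (𝕜 := ℂ) M).le_opNorm _) (norm_nonneg _))
  rw [toEuclideanCLM_toLp, EuclideanSpace.inner_toLp_toLp, dotProduct_comm] at h
  calc _ ≤ _ := h
    _ = _ := by rw [opNorm]; ring

theorem opNorm_le_of_norm_star_dotProduct_mulVec_le {ι : Type*} [Fintype ι] [DecidableEq ι]
    {M : Matrix ι ι ℂ} {C : ℝ} (hC : 0 ≤ C)
    (h : ∀ x y : ι → ℂ, ‖star y ⬝ᵥ M *ᵥ x‖ ≤ C * (‖WithLp.toLp 2 x‖ * ‖WithLp.toLp 2 y‖)) :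
    opNorm M ≤ C := by
  refine ContinuousLinearMap.opNorm_le_of_re_inner_le (𝕜 := ℂ) hC fun x y hx hy => ?_
  have hxy := h x.ofLp y.ofLp
  rw [WithLp.toLp_ofLp, WithLp.toLp_ofLp, hx, hy, mul_one, mul_one] at hxy
  refine (RCLike.re_le_norm _).trans ?_
  rwa [norm_inner_symm, EuclideanSpace.inner_eq_star_dotProduct, ofLp_toEuclideanCLM,
    dotProduct_comm]

theorem star_vec_dotProduct_sum_kronecker_mulVec_vec {ι m n k l : Type*} [Fintype ι]
    [Fintype m] [Fintype n] [Fintype k] [Fintype l]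
    (A : ι → Matrix m m ℂ) (B : ι → Matrix n n ℂ) (G₁ : Matrix k n ℂ) (G₂ : Matrix k m ℂ)
    (H₁ : Matrix l n ℂ) (H₂ : Matrix l m ℂ) :
    star (H₁ᴴ * H₂).vec ⬝ᵥ (∑ i, mconj (A i) ⊗ₖ B i) *ᵥ (G₁ᴴ * G₂).vec =
      ∑ i, ((H₂ * A i * G₂ᴴ)ᴴ * (H₁ * B i * G₁ᴴ)).trace := by
  rw [sum_mulVec, dotProduct_sum]
  refine Finset.sum_congr rfl fun i _ => ?_
  have hA : (mconj (A i))ᵀ = (A i)ᴴ := rfl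
  rw [kronecker_mulVec_vec, star_vec_dotProduct_vec, hA]
  simp only [conjTranspose_mul, conjTranspose_conjTranspose, Matrix.mul_assoc]
  rw [trace_mul_comm G₂, Matrix.mul_assoc, trace_mul_comm (A i)ᴴ]
  simp only [Matrix.mul_assoc]

theorem norm_sum_trace_conjTranspose_mul_sq_le {ι m n : Type*} [Fintype ι] [Fintype m]
    [Fintype n] (K L : ι → Matrix m n ℂ) :
    ‖∑ i, ((K i)ᴴ * L i).trace‖ ^ 2 ≤
      ‖∑ i, ((K i)ᴴ * K i).trace‖ * ‖∑ i, ((L i)ᴴ * L i).trace‖ := by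
  have hre (K : ι → Matrix m n ℂ) :
      ∑ i, ‖WithLp.toLp 2 (K i).vec‖ ^ 2 ≤ ‖∑ i, ((K i)ᴴ * K i).trace‖ := by
    simp only [norm_toLp_vec_sq, ← Complex.re_sum]
    exact Complex.re_le_norm _
  have hle : ‖∑ i, ((K i)ᴴ * L i).trace‖ ≤
      ∑ i, ‖WithLp.toLp 2 (K i).vec‖ * ‖WithLp.toLp 2 (L i).vec‖ := by
    refine (norm_sum_le _ _).trans (Finset.sum_le_sum fun i _ => ?_)
    rw [← star_vec_dotProduct_vec, dotProduct_comm, ← EuclideanSpace.inner_toLp_toLp]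
    exact norm_inner_le_norm _ _
  calc _ ≤ _ := pow_le_pow_left₀ (norm_nonneg _) hle 2
    _ ≤ _ := Finset.sum_mul_sq_le_sq_mul_sq _ _ _
    _ ≤ _ := by gcongr <;> exact hre _

theorem norm_star_dotProduct_sum_kronecker_sq_le {ι m n : Type*} [Fintype ι] [Fintype m]
    [DecidableEq m] [Fintype n] [DecidableEq n]
    (A : ι → Matrix m m ℂ) (B : ι → Matrix n n ℂ) (X Y : Matrix n m ℂ) :
    ‖star Y.vec ⬝ᵥ (∑ i, mconj (A i) ⊗ₖ B i) *ᵥ X.vec‖ ^ 2 ≤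
      opNorm (∑ i, mconj (A i) ⊗ₖ A i) * opNorm (∑ i, mconj (B i) ⊗ₖ B i) *
        (‖WithLp.toLp 2 X.vec‖ * ‖WithLp.toLp 2 Y.vec‖) ^ 2 := by
  obtain ⟨G₁, G₂, hX, hG₁, hG₂⟩ := exists_balanced_factorization X
  obtain ⟨H₁, H₂, hY, hH₁, hH₂⟩ := exists_balanced_factorization Y
  have hnorm {Z : Matrix n m ℂ} {F : Matrix (n ⊕ m) n ℂ} (h : (Fᴴ * F) * (Fᴴ * F) = Z * Zᴴ) :
      ‖WithLp.toLp 2 (Fᴴ * F).vec‖ = ‖WithLp.toLp 2 Z.vec‖ := by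
    rw [← norm_toLp_vec_conjTranspose Z]
    exact norm_toLp_vec_eq_of_mul_self (by rw [h, conjTranspose_conjTranspose])
  have hA := norm_star_dotProduct_mulVec_le (∑ i, mconj (A i) ⊗ₖ A i)
    (G₂ᴴ * G₂).vec (H₂ᴴ * H₂).vec
  have hB := norm_star_dotProduct_mulVec_le (∑ i, mconj (B i) ⊗ₖ B i)
    (G₁ᴴ * G₁).vec (H₁ᴴ * H₁).vec
  rw [norm_toLp_vec_eq_of_mul_self hG₂, norm_toLp_vec_eq_of_mul_self hH₂,
    star_vec_dotProduct_sum_kronecker_mulVec_vec] at hA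
  rw [hnorm hG₁, hnorm hH₁, star_vec_dotProduct_sum_kronecker_mulVec_vec] at hB
  rw [← hX, ← hY, star_vec_dotProduct_sum_kronecker_mulVec_vec, hX, hY]
  calc _ ≤ _ := norm_sum_trace_conjTranspose_mul_sq_le _ _
    _ ≤ _ := mul_le_mul hA hB (norm_nonneg _) ((norm_nonneg _).trans hA)
    _ = _ := by ring

/-- **Matrix Cauchy–Schwarz inequality.**
`‖Σ_i conj(A_i) ⊗ B_i‖² ≤ ‖Σ_i conj(A_i) ⊗ A_i‖ · ‖Σ_i conj(B_i) ⊗ B_i‖`. -/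
theorem matrix_cauchy_schwarz (d d' : ℕ) (hd : 1 ≤ d) (hd' : 1 ≤ d') (n : ℕ)
    (A : Fin n → Matrix (Fin d) (Fin d) ℂ) (B : Fin n → Matrix (Fin d') (Fin d') ℂ) :
    opNorm (∑ i, mconj (A i) ⊗ₖ B i) ^ 2
      ≤ opNorm (∑ i, mconj (A i) ⊗ₖ A i) * opNorm (∑ i, mconj (B i) ⊗ₖ B i) := by
  have hα : 0 ≤ opNorm (∑ i, mconj (A i) ⊗ₖ A i) := norm_nonneg _
  have hβ : 0 ≤ opNorm (∑ i, mconj (B i) ⊗ₖ B i) := norm_nonneg _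
  refine (Real.le_sqrt (norm_nonneg _) (mul_nonneg hα hβ)).1 ?_
  refine opNorm_le_of_norm_star_dotProduct_mulVec_le (Real.sqrt_nonneg _) fun x y => ?_
  obtain ⟨X, rfl⟩ := vec_bijective.surjective x
  obtain ⟨Y, rfl⟩ := vec_bijective.surjective y
  refine (sq_le_sq₀ (norm_nonneg _) (by positivity)).1 ?_
  rw [mul_pow, Real.sq_sqrt (mul_nonneg hα hβ)]
  exact norm_star_dotProduct_sum_kronecker_sq_le A B X Y
end
end

section
/- Let G be a two-player game and G' the associated projection game defined as follows: the first player's question set is 𝒰∪𝒱 (disjoint union) and answer set is 𝒜∪ℬ; the second player's question set is 𝒰×𝒱 and answer set is 𝒜×ℬ; questions are distributed by drawing (u,v) ∼ μ, sending (u,v) to the second player, and sending to the first player either u or v, each with probability 1/2; on the question pair (u,(u,v)) a second-player answer (a,b) projects to a if (a,b,u,v) ∈ V and has no valid first-player answer otherwise, and on (v,(u,v)) it projects to b if (a,b,u,v) ∈ V and has no valid answer otherwise. Then 1 − val(G') ≤ 1 − val(G) ≤ 2(1 − val(G')). -/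
noncomputable section
open scoped Kronecker ComplexOrder
open Matrix

/-- A general two-player one-round game. -/
structure Game where
  U : Type
  V : Type
  A : Type
  B : Type
  [fU : Fintype U]
  [fV : Fintype V]
  [fA : Fintype A]
  [fB : Fintype B]
  [dU : DecidableEq U]
  [dV : DecidableEq V]
  [dA : DecidableEq A]
  [dB : DecidableEq B]
  μ : U → V → ℝ
  μ_nonneg : ∀ u v, 0 ≤ μ u v
  μ_sum : ∑ u, ∑ v, μ u v = 1
  Acc : U → V → A → B → Prop
  [dAcc : ∀ u v a b, Decidable (Acc u v a b)]

attribute [instance] Game.fU Game.fV Game.fA Game.fB Game.dU Game.dV Game.dA Game.dB Game.dAcc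

namespace Game

variable (G : Game)

/-- The classical value of a game. -/
noncomputable def clVal : ℝ :=
  sSup { x | ∃ (f : G.U → G.A) (g : G.V → G.B),
    x = ∑ u, ∑ v, G.μ u v * (if G.Acc u v (f u) (g v) then 1 else 0) }

/-- A `d`-dimensional quantum strategy for the first player. -/
def IsStrategyA {d : ℕ} (A : G.U → G.A → Mat d) : Prop := ∀ u, IsPOVM (A u)

/-- A `d`-dimensional quantum strategy for the second player. -/
def IsStrategyB {d : ℕ} (B : G.V → G.B → Mat d) : Prop := ∀ v, IsPOVM (B v)

/-- Success probability of a pair of quantum strategies with shared state `ψ`. -/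
def pay {d : ℕ} (A : G.U → G.A → Mat d) (B : G.V → G.B → Mat d)
    (ψ : Fin d × Fin d → ℂ) : ℝ :=
  ∑ u, ∑ v, G.μ u v * ∑ a, ∑ b,
    if G.Acc u v a b then (braket ψ (mconj (A u a) ⊗ₖ B v b)).re else 0

/-- The entangled value `val*(G)`. -/
noncomputable def entVal : ℝ :=
  sSup { x | ∃ (d : ℕ) (A : G.U → G.A → Mat d) (B : G.V → G.B → Mat d)
    (ψ : Fin d × Fin d → ℂ),
    G.IsStrategyA A ∧ G.IsStrategyB B ∧ enormSq ψ = 1 ∧ x = G.pay A B ψ }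

/-- The projection game `G'` associated to a general game `G`: the second player receives the
pair `(u,v)` and answers `(a,b)`; the first player receives `u` or `v` (each w.p. `1/2`) and must
answer the corresponding component, valid only if `(a,b,u,v)` is accepted in `G`. -/
def toProj : Game where
  U := G.U ⊕ G.V
  V := G.U × G.V
  A := G.A ⊕ G.B
  B := G.A × G.B
  μ := fun q p =>
    Sum.elim (fun u => if u = p.1 then G.μ p.1 p.2 / 2 else 0)
      (fun v => if v = p.2 then G.μ p.1 p.2 / 2 else 0) q
  μ_nonneg := by
    intro q p
    rcases q with u | v <;> dsimp only [Sum.elim_inl, Sum.elim_inr] <;> split <;>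
      first
        | exact div_nonneg (G.μ_nonneg _ _) (by norm_num)
        | exact le_refl 0
  μ_sum := by
    rw [Fintype.sum_sum_type]
    simp only [Sum.elim_inl, Sum.elim_inr]
    have h1 : (∑ u, ∑ p : G.U × G.V, if u = p.1 then G.μ p.1 p.2 / 2 else 0)
        = ∑ p : G.U × G.V, G.μ p.1 p.2 / 2 := by
      rw [Finset.sum_comm]
      exact Finset.sum_congr rfl fun p _ => by simp
    have h2 : (∑ v, ∑ p : G.U × G.V, if v = p.2 then G.μ p.1 p.2 / 2 else 0)
        = ∑ p : G.U × G.V, G.μ p.1 p.2 / 2 := by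
      rw [Finset.sum_comm]
      exact Finset.sum_congr rfl fun p _ => by simp
    rw [h1, h2, ← Finset.sum_add_distrib]
    have h3 : (∑ p : G.U × G.V, (G.μ p.1 p.2 / 2 + G.μ p.1 p.2 / 2))
        = ∑ u, ∑ v, G.μ u v := by
      rw [Fintype.sum_prod_type]
      exact Finset.sum_congr rfl fun u _ => Finset.sum_congr rfl fun v _ => by ring
    rw [h3, G.μ_sum]
  Acc := fun q p x y =>
    match q, x with
    | Sum.inl _, Sum.inl a => G.Acc p.1 p.2 y.1 y.2 ∧ a = y.1
    | Sum.inr _, Sum.inr b => G.Acc p.1 p.2 y.1 y.2 ∧ b = y.2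
    | _, _ => False
  dAcc := by
    intro q p x y
    rcases q with u | v <;> rcases x with a | b <;> dsimp only <;> infer_instance

end Game

namespace Game

variable (G : Game)

/-- The indicator of acceptance, as a real number. -/
def win (u : G.U) (v : G.V) (a : G.A) (b : G.B) : ℝ := if G.Acc u v a b then 1 else 0

/-- The success probability of a pair of deterministic strategies. -/
def detPay (f : G.U → G.A) (g : G.V → G.B) : ℝ :=
  ∑ u, ∑ v, G.μ u v * G.win u v (f u) (g v)

lemma detPay_nonneg (f : G.U → G.A) (g : G.V → G.B) : 0 ≤ G.detPay f g :=
  Finset.sum_nonneg fun u _ => Finset.sum_nonneg fun v _ =>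
    mul_nonneg (G.μ_nonneg u v) (by unfold win; split_ifs <;> norm_num)

lemma detPay_le_one (f : G.U → G.A) (g : G.V → G.B) : G.detPay f g ≤ 1 := by
  rw [← G.μ_sum]
  refine Finset.sum_le_sum fun u _ => Finset.sum_le_sum fun v _ =>
    mul_le_of_le_one_right (G.μ_nonneg u v) ?_
  unfold win
  split_ifs <;> norm_num

lemma detPay_le_clVal (f : G.U → G.A) (g : G.V → G.B) : G.detPay f g ≤ G.clVal := by
  refine le_csSup ⟨1, ?_⟩ ⟨f, g, rfl⟩
  rintro x ⟨f, g, rfl⟩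
  exact G.detPay_le_one f g

lemma clVal_nonneg : 0 ≤ G.clVal := by
  refine Real.sSup_nonneg ?_
  rintro x ⟨f, g, rfl⟩
  exact G.detPay_nonneg f g

lemma clVal_le {c : ℝ} (hc : 0 ≤ c) (h : ∀ f g, G.detPay f g ≤ c) : G.clVal ≤ c := by
  refine Real.sSup_le ?_ hc
  rintro x ⟨f, g, rfl⟩
  exact h f g

lemma toProj_detPay (F : G.U ⊕ G.V → G.A ⊕ G.B) (g : G.U × G.V → G.A × G.B) :
    G.toProj.detPay F g = ∑ u, ∑ v, G.μ u v / 2 *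
      (G.toProj.win (Sum.inl u) (u, v) (F (Sum.inl u)) (g (u, v)) +
        G.toProj.win (Sum.inr v) (u, v) (F (Sum.inr v)) (g (u, v))) := by
  change ∑ q : G.U ⊕ G.V, ∑ p : G.U × G.V, G.toProj.μ q p * G.toProj.win q p (F q) (g p) = _
  rw [Finset.sum_comm, Fintype.sum_prod_type]
  refine Finset.sum_congr rfl fun u _ => Finset.sum_congr rfl fun v _ => ?_
  rw [Fintype.sum_sum_type, mul_add]
  congr 1
  · rw [Finset.sum_eq_single u]
    · simp [toProj]
    · intro u' _ hu
      simp [toProj, hu]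
    · simp
  · rw [Finset.sum_eq_single v]
    · simp [toProj]
    · intro v' _ hv
      simp [toProj, hv]
    · simp

lemma detPay_eq_toProj_detPay (f : G.U → G.A) (g : G.V → G.B) :
    G.toProj.detPay (Sum.map f g) (Prod.map f g) = G.detPay f g := by
  refine (G.toProj_detPay _ _).trans
    (Finset.sum_congr rfl fun u _ => Finset.sum_congr rfl fun v _ => ?_)
  by_cases h : G.Acc u v (f u) (g v) <;> simp [win, toProj, h]
  ring

/-- A strategy of the first player in `G.toProj` yields strategies for both players of `G`, by
replacing answers of the wrong type with default ones. -/
lemma toProj_detPay_le [Inhabited G.A] [Inhabited G.B]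
    (F : G.U ⊕ G.V → G.A ⊕ G.B) (g : G.U × G.V → G.A × G.B) :
    G.toProj.detPay F g ≤ (1 + G.detPay (fun u => (F (Sum.inl u)).elim id fun _ => default)
      (fun v => (F (Sum.inr v)).elim (fun _ => default) id)) / 2 := by
  rw [toProj_detPay, ← G.μ_sum, detPay, ← Finset.sum_add_distrib, Finset.sum_div]
  refine Finset.sum_le_sum fun u _ => ?_
  rw [← Finset.sum_add_distrib, Finset.sum_div]
  refine Finset.sum_le_sum fun v _ => ?_
  rw [← mul_one_add, mul_div_right_comm]
  refine mul_le_mul_of_nonneg_left ?_ (div_nonneg (G.μ_nonneg u v) zero_le_two)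
  have both : G.toProj.Acc (Sum.inl u) (u, v) (F (Sum.inl u)) (g (u, v)) →
      G.toProj.Acc (Sum.inr v) (u, v) (F (Sum.inr v)) (g (u, v)) →
      G.Acc u v ((F (Sum.inl u)).elim id fun _ => default)
        ((F (Sum.inr v)).elim (fun _ => default) id) := by
    rcases F (Sum.inl u) with a | b <;> rcases F (Sum.inr v) with a' | b'
    · exact fun _ h => h.elim
    · rintro ⟨h, rfl⟩ ⟨-, rfl⟩
      exact h
    · exact fun h => h.elim
    · exact fun h => h.elim
  unfold win
  split_ifs <;> first | tauto | norm_num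

lemma clVal_le_toProj_clVal : G.clVal ≤ G.toProj.clVal :=
  G.clVal_le G.toProj.clVal_nonneg fun f g =>
    (G.detPay_eq_toProj_detPay f g).symm.trans_le (G.toProj.detPay_le_clVal _ _)

lemma toProj_clVal_le : G.toProj.clVal ≤ (1 + G.clVal) / 2 := by
  refine G.toProj.clVal_le (by linarith [G.clVal_nonneg]) fun F g => ?_
  have hne : Nonempty (G.U × G.V) := by
    by_contra h
    have h0 := G.μ_sum
    rw [← Fintype.sum_prod_type', Finset.univ_eq_empty_iff.mpr (not_nonempty_iff.mp h)] at h0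
    simp at h0
  obtain ⟨p⟩ := hne
  let _ : Inhabited G.A := ⟨(g p).1⟩
  let _ : Inhabited G.B := ⟨(g p).2⟩
  exact (G.toProj_detPay_le F g).trans (by gcongr; exact G.detPay_le_clVal _ _)

end Game

/-- Classical values of a game and of its associated projection game:
`1 − val(G') ≤ 1 − val(G) ≤ 2(1 − val(G'))`. -/
theorem clVal_toProj (G : Game) :
    1 - G.toProj.clVal ≤ 1 - G.clVal ∧ 1 - G.clVal ≤ 2 * (1 - G.toProj.clVal) := by
  constructor <;> linarith [G.clVal_le_toProj_clVal, G.toProj_clVal_le]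
end
end

section
/- Let G be a two-player game and G' the associated projection game defined as follows: the first player's question set is 𝒰∪𝒱 (disjoint union) and answer set is 𝒜∪ℬ; the second player's question set is 𝒰×𝒱 and answer set is 𝒜×ℬ; questions are distributed by drawing (u,v) ∼ μ, sending (u,v) to the second player, and sending to the first player either u or v, each with probability 1/2; on the question pair (u,(u,v)) a second-player answer (a,b) projects to a if (a,b,u,v) ∈ V and has no valid first-player answer otherwise, and on (v,(u,v)) it projects to b if (a,b,u,v) ∈ V and has no valid answer otherwise. Then the entangled values satisfy val*(G') ≤ √((1 + val*(G))/2). -/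
noncomputable section
open scoped Kronecker ComplexOrder
open Matrix

section BilinearForms

variable {V : Type*} [AddCommGroup V] [Module ℝ V]

theorem pair_diag (β : LinearMap.BilinForm ℝ V) (hs : ∀ x y, β x y = β y x)
    (hp : ∀ x, 0 ≤ β x x) (e a b : V) (ν : ℝ) :
    7 / 16 * β (e - a) (e - b) + (β a (e - a) + 9 / 32 * β (e - a) (e - a))
      + (β b (e - b) + 9 / 32 * β (e - b) (e - b))
    ≤ (3 - 4 * ν + 2 * ν ^ 2) * β e e - (1 - ν) * β (a + b + a + b) e + β a b := by
  have h1 := hp ((2 * ν) • e - (e - a) - (e - b))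
  have h2 := hp (a - b)
  have s1 := hs a e
  have s2 := hs b e
  have s3 := hs b a
  simp only [map_add, map_sub, map_smul, LinearMap.add_apply, LinearMap.sub_apply,
    LinearMap.smul_apply, smul_eq_mul, s1, s2, s3] at *
  nlinarith

theorem pair_generic (β : LinearMap.BilinForm ℝ V) (hs : ∀ x y, β x y = β y x)
    (hp : ∀ x, 0 ≤ β x x) (e a a' b b' : V) (ν : ℝ) (hν : ν ≤ 1 / 2) :
    7 / 16 * β (e - a - a') (e - b - b')
      + (β a a' + 3 / 4 * β (a + a') (e - a - a') + 9 / 32 * β (e - a - a') (e - a - a'))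
      + (β b b' + 3 / 4 * β (b + b') (e - b - b') + 9 / 32 * β (e - b - b') (e - b - b'))
    ≤ (3 - 4 * ν + 2 * ν ^ 2) * β e e - (1 - ν) * β (a + b + a' + b') e + β a b + β a' b' := by
  have h1 := hp (a - a' + b - b')
  have h2 := hp (a + a' - b - b')
  have h3 := hp (a + a' + b + b' + (4 * (ν - 3 / 4)) • e)
  have h4 := mul_nonneg (sub_nonneg.2 hν) (hp e)
  have h5 := hp e
  have s1 := hs a e
  have s2 := hs b e
  have s3 := hs b a
  have s4 := hs a' e
  have s5 := hs b' e
  have s6 := hs a' a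
  have s7 := hs b' b
  have s8 := hs b' a
  have s9 := hs b a'
  have s10 := hs b' a'
  simp only [map_add, map_sub, map_smul, LinearMap.add_apply, LinearMap.sub_apply,
    LinearMap.smul_apply, smul_eq_mul, s1, s2, s3, s4, s5, s6, s7, s8, s9, s10] at *
  linarith

theorem pair_column (β : LinearMap.BilinForm ℝ V) (hs : ∀ x y, β x y = β y x)
    (hp : ∀ x, 0 ≤ β x x) (e a a' b : V) (ν : ℝ) (hν : ν ≤ 1 / 2) :
    7 / 16 * β (e - a - a') (e - b)
      + (β a a' + 3 / 4 * β (a + a') (e - a - a') + 9 / 32 * β (e - a - a') (e - a - a'))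
      + (β b (e - b) + 9 / 32 * β (e - b) (e - b))
    ≤ (3 - 4 * ν + 2 * ν ^ 2) * β e e - (1 - ν) * β (a + b + a' + b) e + β a b + β a' b := by
  have h1 := hp (a - a')
  have h2 := hp ((e - b) + (9 / 23 : ℝ) • (e - a - a') - (32 / 23 * ν) • e)
  have h3 := hp ((e - a - a') - (23 / 20 + ν) • e)
  have h4 := mul_nonneg (show 0 ≤ 97 / 160 - 5 / 4 * ν + 1 / 2 * ν ^ 2 by nlinarith) (hp e)
  have s1 := hs a e
  have s2 := hs b e
  have s3 := hs b a
  have s4 := hs a' e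
  have s6 := hs a' a
  have s9 := hs b a'
  simp only [map_add, map_sub, map_smul, LinearMap.add_apply, LinearMap.sub_apply,
    LinearMap.smul_apply, smul_eq_mul, s1, s2, s3, s4, s6, s9] at *
  linarith

theorem sum_sum_weight {X Y : Type*} [Fintype X] [Fintype Y] (β : LinearMap.BilinForm ℝ V)
    (A : X → V) (B : Y → V) (c : X → ℝ) (k : Y → ℝ) :
    ∑ i, ∑ j, c i * k j * β (A i) (B j) = β (∑ i, c i • A i) (∑ j, k j • B j) := by
  simp only [map_sum, LinearMap.sum_apply, map_smul, LinearMap.smul_apply, smul_eq_mul,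
    Finset.mul_sum, mul_assoc]
  rw [Finset.sum_comm]
  exact Finset.sum_congr rfl fun i _ => Finset.sum_congr rfl fun j _ => by ring

section Mask
variable {X Y : Type*} [Fintype X] [Fintype Y] [DecidableEq X] [DecidableEq Y]

/-- The weight of the column `x` in the mask attached to the pair of outcomes `(i, i')`. -/
noncomputable def maskWeight (i i' x : X) : ℝ :=
  if i = x then (if i' = x then 0 else 1) else if i' = x then 1 else 3 / 4

/-- The weight vanishing at `x` and equal to `1` elsewhere. -/
noncomputable def offWeight (x i : X) : ℝ := if i = x then 0 else 1

theorem sum_offWeight_smul (A : X → V) (x : X) :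
    ∑ i, offWeight x i • A i = ∑ i, A i - A x := by
  have : ∀ i, offWeight x i • A i = A i - if i = x then A i else 0 := by
    intro i
    by_cases h : i = x <;> simp [offWeight, h]
  simp only [this, Finset.sum_sub_distrib, Finset.sum_ite_eq', Finset.mem_univ, if_true]

theorem sum_offWeight_mul_self_smul (A : X → V) (x : X) :
    ∑ i, (offWeight x i * offWeight x i) • A i = ∑ i, A i - A x := by
  have : ∀ i, offWeight x i * offWeight x i = offWeight x i := by
    intro i
    by_cases h : i = x <;> simp [offWeight, h]
  simp only [this, sum_offWeight_smul]

theorem sum_offWeight_mul_smul (A : X → V) {x x' : X} (h : x ≠ x') :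
    ∑ i, (offWeight x i * offWeight x' i) • A i = ∑ i, A i - A x - A x' := by
  have : ∀ i, (offWeight x i * offWeight x' i) • A i
      = A i - (if i = x then A i else 0) - (if i = x' then A i else 0) := by
    intro i
    by_cases h1 : i = x <;> by_cases h2 : i = x' <;> simp_all [offWeight]
  simp only [this, Finset.sum_sub_distrib, Finset.sum_ite_eq', Finset.mem_univ, if_true]

theorem sum_maskWeight_self (β : LinearMap.BilinForm ℝ V) (hs : ∀ x y, β x y = β y x)
    (A : X → V) (x : X) :
    ∑ i, ∑ i', maskWeight i i' x * maskWeight i i' x * β (A i) (A i')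
      = 2 * β (A x) (∑ i, A i - A x)
        + 9 / 16 * β (∑ i, A i - A x) (∑ i, A i - A x) := by
  have key : ∀ i i', maskWeight i i' x * maskWeight i i' x * β (A i) (A i')
      = (if i = x then 1 else 0) * offWeight x i' * β (A i) (A i')
        + offWeight x i * (if i' = x then 1 else 0) * β (A i) (A i')
        + 9 / 16 * (offWeight x i * offWeight x i'
          * β (A i) (A i')) := by
    intro i i'
    unfold maskWeight offWeight
    split_ifs <;> ring
  simp only [key, Finset.sum_add_distrib, ← Finset.mul_sum, sum_sum_weight, sum_offWeight_smul]
  rw [hs (∑ i, A i - A x)]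
  simp
  ring

theorem sum_maskWeight_of_ne (β : LinearMap.BilinForm ℝ V) (hs : ∀ x y, β x y = β y x)
    (A : X → V) {x x' : X} (h : x ≠ x') :
    ∑ i, ∑ i', maskWeight i i' x * maskWeight i i' x' * β (A i) (A i')
      = 2 * β (A x) (A x') + 3 / 2 * β (A x + A x') (∑ i, A i - A x - A x')
        + 9 / 16 * β (∑ i, A i - A x - A x') (∑ i, A i - A x - A x') := by
  let d (y i : X) : ℝ := if i = y then 1 else 0
  let o (i : X) : ℝ := offWeight x i * offWeight x' i
  have hd : ∀ y, ∑ i, d y i • A i = A y := fun y => by simp [d]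
  have ho : ∑ i, o i • A i = ∑ i, A i - A x - A x' := sum_offWeight_mul_smul A h
  have key : ∀ i i', maskWeight i i' x * maskWeight i i' x' * β (A i) (A i')
      = d x i * d x' i' * β (A i) (A i') + d x' i * d x i' * β (A i) (A i')
        + 3 / 4 * (d x i * o i' * β (A i) (A i') + d x' i * o i' * β (A i) (A i')
          + o i * d x i' * β (A i) (A i') + o i * d x' i' * β (A i) (A i'))
        + 9 / 16 * (o i * o i' * β (A i) (A i')) := by
    intro i i'
    simp only [maskWeight, d, o, offWeight]
    split_ifs <;> first | (exfalso; simp_all; done) | ring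
  simp only [key, Finset.sum_add_distrib, ← Finset.mul_sum, sum_sum_weight, hd, ho]
  rw [hs (∑ i, A i - A x - A x') (A x), hs (∑ i, A i - A x - A x') (A x'), hs (A x') (A x),
    map_add, LinearMap.add_apply]
  ring

theorem pair_inequality (β : LinearMap.BilinForm ℝ V) (hs : ∀ x y, β x y = β y x)
    (hp : ∀ x, 0 ≤ β x x) (e : V) (A : X → V) (B : Y → V) (hA : ∑ i, A i = e)
    (hB : ∑ j, B j = e) (ν : ℝ) (hν : ν ≤ 1 / 2) (w w' : X × Y) :
    7 / 16 * ∑ i, ∑ j, (offWeight w.1 i * offWeight w.2 j)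
        * (offWeight w'.1 i * offWeight w'.2 j)
        * β (A i) (B j)
      + 1 / 2 * ∑ i, ∑ i', maskWeight i i' w.1 * maskWeight i i' w'.1 * β (A i) (A i')
      + 1 / 2 * ∑ j, ∑ j', maskWeight j j' w.2 * maskWeight j j' w'.2 * β (B j) (B j')
    ≤ (3 - 4 * ν + 2 * ν ^ 2) * β e e
      - (1 - ν) * β (A w.1 + B w.2 + A w'.1 + B w'.2) e
      + β (A w.1) (B w.2) + β (A w'.1) (B w'.2)
      - if w = w' then β (A w.1) (B w.2) else 0 := by
  obtain ⟨x, y⟩ := w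
  obtain ⟨x', y'⟩ := w'
  have hG : ∑ i, ∑ j, (offWeight x i * offWeight y j)
        * (offWeight x' i * offWeight y' j)
        * β (A i) (B j)
      = β (∑ i, (offWeight x i * offWeight x' i) • A i)
        (∑ j, (offWeight y j * offWeight y' j) • B j) := by
    rw [← sum_sum_weight]
    exact Finset.sum_congr rfl fun i _ => Finset.sum_congr rfl fun j _ => by ring
  simp only [hG]
  by_cases hx : x = x' <;> by_cases hy : y = y'
  · subst hx hy
    simp only [sum_offWeight_mul_self_smul, sum_maskWeight_self β hs, hA, hB]
    have := pair_diag β hs hp e (A x) (B y) ν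
    simp only [if_true]
    linarith
  · subst hx
    simp only [sum_offWeight_mul_self_smul, sum_offWeight_mul_smul B hy, sum_maskWeight_self β hs,
      sum_maskWeight_of_ne β hs B hy, hA, hB, Prod.mk.injEq, hy, and_false, if_false]
    have := pair_column β hs hp e (B y) (B y') (A x) ν hν
    rw [hs (e - A x), hs (A x) (B y), hs (A x) (B y'),
      show A x + B y + A x + B y' = B y + A x + B y' + A x by abel]
    linarith
  · subst hy
    simp only [sum_offWeight_mul_self_smul, sum_offWeight_mul_smul A hx, sum_maskWeight_self β hs,
      sum_maskWeight_of_ne β hs A hx, hA, hB, Prod.mk.injEq, hx, false_and, if_false]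
    have := pair_column β hs hp e (A x) (A x') (B y) ν hν
    linarith
  · simp only [sum_offWeight_mul_smul A hx, sum_offWeight_mul_smul B hy,
      sum_maskWeight_of_ne β hs A hx, sum_maskWeight_of_ne β hs B hy, hA, hB,
      Prod.mk.injEq, hx, false_and, if_false]
    have := pair_generic β hs hp e (A x) (A x') (B y) (B y') ν hν
    linarith

end Mask

end BilinearForms

section MatrixForm
variable {n : Type*} [Fintype n]

/-- The real part of the trace, as a real-linear form. -/
noncomputable def reTr : Matrix n n ℂ →ₗ[ℝ] ℝ := Complex.reLm ∘ₗ Matrix.traceLinearMap n ℝ ℂ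

theorem reTr_apply (M : Matrix n n ℂ) : reTr M = M.trace.re := rfl

theorem reTr_mul_comm (M N : Matrix n n ℂ) : reTr (M * N) = reTr (N * M) := by
  rw [reTr_apply, reTr_apply, trace_mul_comm]

theorem reTr_conjTranspose (M : Matrix n n ℂ) : reTr Mᴴ = reTr M := by
  rw [reTr_apply, reTr_apply, trace_conjTranspose]
  simp

theorem reTr_nonneg {M : Matrix n n ℂ} (hM : M.PosSemidef) : 0 ≤ reTr M :=
  (Complex.le_def.1 hM.trace_nonneg).1

theorem Matrix.PosSemidef.exists_conjTranspose_mul_self {M : Matrix n n ℂ}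
    (hM : M.PosSemidef) : ∃ C : Matrix n n ℂ, M = Cᴴ * C := by
  classical
  open scoped MatrixOrder in
  exact CStarAlgebra.nonneg_iff_eq_star_mul_self.1 (nonneg_iff_posSemidef.2 hM)

theorem reTr_mul_nonneg {M N : Matrix n n ℂ} (hM : M.PosSemidef) (hN : N.PosSemidef) :
    0 ≤ reTr (M * N) := by
  obtain ⟨C, rfl⟩ := hM.exists_conjTranspose_mul_self
  rw [Matrix.mul_assoc, reTr_mul_comm]
  exact reTr_nonneg (hN.mul_mul_conjTranspose_same C)

theorem reTr_sandwich_nonneg {P Q L : Matrix n n ℂ} (hP : P.PosSemidef) (hQ : Q.PosSemidef)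
    (hL : L.IsHermitian) : 0 ≤ reTr (P * L * Q * L) := by
  have := reTr_mul_nonneg hP (hQ.mul_mul_conjTranspose_same L)
  rwa [hL.eq, ← Matrix.mul_assoc, ← Matrix.mul_assoc] at this

/-- The real bilinear form `(P, Q) ↦ Re Tr (H Pᴴ H' Q)`. -/
noncomputable def traceForm (H H' : Matrix n n ℂ) : LinearMap.BilinForm ℝ (Matrix n n ℂ) :=
  LinearMap.mk₂ ℝ (fun P Q => reTr (H * Pᴴ * H' * Q))
    (by intros; simp [Matrix.mul_add, Matrix.add_mul])
    (by intros; simp)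
    (by intros; simp [Matrix.mul_add])
    (by intros; simp)

theorem traceForm_apply (H H' P Q : Matrix n n ℂ) :
    traceForm H H' P Q = reTr (H * Pᴴ * H' * Q) := rfl

theorem traceForm_comm {H H' : Matrix n n ℂ} (hH : H.IsHermitian) (hH' : H'.IsHermitian)
    (P Q : Matrix n n ℂ) : traceForm H H' P Q = traceForm H H' Q P := by
  rw [traceForm_apply, ← reTr_conjTranspose]
  simp only [conjTranspose_mul, conjTranspose_conjTranspose, hH.eq, hH'.eq]
  rw [← Matrix.mul_assoc, ← Matrix.mul_assoc, reTr_mul_comm, traceForm_apply]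
  simp only [Matrix.mul_assoc]

theorem traceForm_self_nonneg {H H' : Matrix n n ℂ} (hH : H.PosSemidef) (hH' : H'.PosSemidef)
    (P : Matrix n n ℂ) : 0 ≤ traceForm H H' P P := by
  have := reTr_mul_nonneg hH (hH'.conjTranspose_mul_mul_same P)
  rwa [← Matrix.mul_assoc, ← Matrix.mul_assoc] at this

theorem sum_sum_traceForm_nonneg {W : Type*} [Fintype W] {H : W → Matrix n n ℂ}
    (hH : ∀ w, (H w).IsHermitian) {P Q : Matrix n n ℂ} (hP : P.PosSemidef)
    (hQ : Q.PosSemidef) (c : W → ℝ) :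
    0 ≤ ∑ w, ∑ w', c w * c w' * traceForm (H w) (H w') P Q := by
  have hL : (∑ w, c w • H w).IsHermitian := by
    simp only [IsHermitian, conjTranspose_sum, conjTranspose_smul, (hH _).eq, star_trivial]
  have := reTr_sandwich_nonneg hQ hP hL
  convert this using 1
  rw [Matrix.mul_assoc, Matrix.mul_assoc, reTr_mul_comm]
  simp only [Finset.sum_mul, Finset.mul_sum, map_sum, smul_mul_assoc, mul_smul_comm, map_smul,
    smul_eq_mul, traceForm_apply, hP.1.eq]
  rw [Finset.sum_comm]
  exact Finset.sum_congr rfl fun i _ => Finset.sum_congr rfl fun j _ => by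
    simp only [Matrix.mul_assoc]; ring

theorem sum_sum_comm_sum_sum {W I J : Type*} [Fintype W] [Fintype I] [Fintype J]
    (f : W → W → I → J → ℝ) :
    ∑ w, ∑ w', ∑ i, ∑ j, f w w' i j = ∑ i, ∑ j, ∑ w, ∑ w', f w w' i j := by
  calc ∑ w, ∑ w', ∑ i, ∑ j, f w w' i j
      = ∑ w, ∑ i, ∑ j, ∑ w', f w w' i j := Finset.sum_congr rfl fun w _ => by
        rw [Finset.sum_comm]
        exact Finset.sum_congr rfl fun i _ => Finset.sum_comm
    _ = ∑ i, ∑ j, ∑ w, ∑ w', f w w' i j := by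
        rw [Finset.sum_comm]
        exact Finset.sum_congr rfl fun i _ => Finset.sum_comm

theorem sum_sum_mask_nonneg {W I J : Type*} [Fintype W] [Fintype I] [Fintype J]
    {H : W → Matrix n n ℂ} (hH : ∀ w, (H w).IsHermitian) {P : I → Matrix n n ℂ}
    {Q : J → Matrix n n ℂ} (hP : ∀ i, (P i).PosSemidef) (hQ : ∀ j, (Q j).PosSemidef)
    (c : I → J → W → ℝ) :
    0 ≤ ∑ w, ∑ w', ∑ i, ∑ j, c i j w * c i j w' * traceForm (H w) (H w') (P i) (Q j) := by
  rw [sum_sum_comm_sum_sum]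
  exact Finset.sum_nonneg fun i _ => Finset.sum_nonneg fun j _ =>
    sum_sum_traceForm_nonneg hH (hP i) (hQ j) (c i j)

theorem masked_inequality [DecidableEq n] {X Y : Type*} [Fintype X] [Fintype Y]
    {A : X → Matrix n n ℂ} {B : Y → Matrix n n ℂ}
    {H : X × Y → Matrix n n ℂ} {s : Matrix n n ℂ} (hA : ∀ x, (A x).PosSemidef)
    (hA1 : ∑ x, A x = 1) (hB : ∀ y, (B y).PosSemidef) (hB1 : ∑ y, B y = 1)
    (hH : ∀ w, (H w).PosSemidef) (hs : ∑ w, H w = s) {ν : ℝ} (hν : ν ≤ 1 / 2) :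
    0 ≤ (3 - 4 * ν + 2 * ν ^ 2) * reTr (s * s)
      - 2 * (1 - ν) * ∑ w, reTr ((A w.1 + B w.2) * H w * s)
      + 2 * ∑ w, reTr (s * A w.1 * H w * B w.2) - ∑ w, reTr (A w.1 * H w * B w.2 * H w) := by
  classical
  have hsH : sᴴ = s := by simp only [← hs, conjTranspose_sum, (hH _).1.eq]
  let β w w' := traceForm (H w) (H w')
  have hβ : ∀ w w' P Q, β w w' P Q = β w w' Q P :=
    fun w w' => traceForm_comm (hH w).1 (hH w').1
  have hpair := Finset.sum_le_sum fun w (_ : w ∈ Finset.univ) =>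
    Finset.sum_le_sum fun w' (_ : w' ∈ Finset.univ) =>
      pair_inequality (β w w') (hβ w w') (traceForm_self_nonneg (hH w) (hH w')) 1 A B hA1 hB1 ν hν
        w w'
  have hM := sum_sum_mask_nonneg (fun w => (hH w).1) hA hA fun i i' w => maskWeight i i' w.1
  have hN := sum_sum_mask_nonneg (fun w => (hH w).1) hB hB fun j j' w => maskWeight j j' w.2
  have hG := sum_sum_mask_nonneg (fun w => (hH w).1) hA hB fun i j w =>
    offWeight w.1 i * offWeight w.2 j
  have hone : ∑ w, ∑ w', β w w' 1 1 = reTr (s * s) := by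
    simp only [β, traceForm_apply, conjTranspose_one, Matrix.mul_one, ← map_sum, ← Finset.mul_sum,
      ← Finset.sum_mul, hs]
  have hlin : ∑ w, ∑ w', β w w' (A w.1 + B w.2 + A w'.1 + B w'.2) 1
      = 2 * ∑ w, reTr ((A w.1 + B w.2) * H w * s) := by
    have hP : ∀ w : X × Y, (A w.1 + B w.2)ᴴ = A w.1 + B w.2 :=
      fun w => ((hA w.1).add (hB w.2)).1
    have h1 : ∑ w, ∑ w', β w w' (A w.1 + B w.2) 1 = ∑ w, reTr ((A w.1 + B w.2) * H w * s) := by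
      refine Finset.sum_congr rfl fun w _ => ?_
      simp only [β, traceForm_apply, hP, Matrix.mul_one, ← map_sum, ← Finset.mul_sum, hs]
      rw [← reTr_conjTranspose]
      simp only [conjTranspose_mul, hP, (hH w).1.eq, hsH]
      rw [reTr_mul_comm]
    have h2 : ∑ w, ∑ w', β w w' (A w'.1 + B w'.2) 1
        = ∑ w, reTr ((A w.1 + B w.2) * H w * s) := by
      rw [Finset.sum_comm]
      refine Finset.sum_congr rfl fun w _ => ?_
      simp only [β, traceForm_apply, hP, Matrix.mul_one, Matrix.mul_assoc, ← map_sum,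
        ← Finset.sum_mul, hs]
      rw [reTr_mul_comm, Matrix.mul_assoc]
    rw [two_mul]
    nth_rewrite 1 [← h1]
    rw [← h2, ← Finset.sum_add_distrib]
    refine Finset.sum_congr rfl fun w _ => ?_
    rw [← Finset.sum_add_distrib]
    refine Finset.sum_congr rfl fun w' _ => ?_
    rw [← LinearMap.add_apply, ← map_add, add_assoc (A w.1 + B w.2)]
  have hcross : ∑ w, ∑ w', β w w' (A w.1) (B w.2) = ∑ w, reTr (s * A w.1 * H w * B w.2) := by
    refine Finset.sum_congr rfl fun w _ => ?_
    simp only [β, traceForm_apply, (hA _).1.eq, ← map_sum, ← Finset.sum_mul, ← Finset.mul_sum, hs]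
    rw [← reTr_conjTranspose]
    simp only [conjTranspose_mul, (hA _).1.eq, (hB _).1.eq, (hH w).1.eq, hsH]
    rw [reTr_mul_comm]
    simp only [Matrix.mul_assoc]
  have hcross' : ∑ w, ∑ w', β w w' (A w'.1) (B w'.2)
      = ∑ w, reTr (s * A w.1 * H w * B w.2) := by
    rw [Finset.sum_comm]
    refine Finset.sum_congr rfl fun w _ => ?_
    simp only [β, traceForm_apply, (hA _).1.eq, Matrix.mul_assoc, ← map_sum, ← Finset.sum_mul, hs]
  have hdiag : ∑ w, β w w (A w.1) (B w.2) = ∑ w, reTr (A w.1 * H w * B w.2 * H w) := by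
    refine Finset.sum_congr rfl fun w _ => ?_
    simp only [β, traceForm_apply, (hA _).1.eq]
    rw [Matrix.mul_assoc, Matrix.mul_assoc, reTr_mul_comm]
    simp only [Matrix.mul_assoc]
  simp only [Finset.sum_add_distrib, Finset.sum_sub_distrib, ← Finset.mul_sum, hone, hlin, hcross,
    hcross', Finset.sum_ite_eq, Finset.mem_univ, if_true, hdiag] at hpair
  linarith

end MatrixForm

section Lyapunov
variable {n W : Type*} [Fintype n] [Fintype W]

theorem Matrix.PosSemidef.apply_eq_zero_of_diag_eq_zero {N : Matrix n n ℂ}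
    (hN : N.PosSemidef) {l : n} (h : N l l = 0) (k : n) : N k l = 0 := by
  classical
  have := (hN.dotProduct_mulVec_zero_iff (Pi.single l 1)).1 (by simp [h])
  simpa using congrFun this k

theorem Matrix.PosSemidef.of_anticommutator {s H N : Matrix n n ℂ} (hs : s.PosSemidef)
    (hN : N.PosSemidef) (hH : H.IsHermitian) (h : s * H + H * s = (2 : ℝ) • N)
    (hker : ∀ v, s *ᵥ v = 0 → H *ᵥ v = 0) : H.PosSemidef := by
  classical
  rw [hH.posSemidef_iff_eigenvalues_nonneg]
  intro i
  set v : n → ℂ := ⇑(hH.eigenvectorBasis i) with hv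
  have hHv : H *ᵥ v = hH.eigenvalues i • v := hH.mulVec_eigenvectorBasis i
  have hv0 : v ≠ 0 := by
    intro h0
    apply hH.eigenvectorBasis.orthonormal.ne_zero i
    ext k
    exact congrFun h0 k
  have hquad : (2 * hH.eigenvalues i : ℝ) * (star v ⬝ᵥ s *ᵥ v).re
      = 2 * (star v ⬝ᵥ N *ᵥ v).re := by
    have h1 : star v ⬝ᵥ (s * H + H * s) *ᵥ v
        = (2 * hH.eigenvalues i : ℝ) * (star v ⬝ᵥ s *ᵥ v) := by
      have h2 : star v ᵥ* H = hH.eigenvalues i • star v := by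
        have := congrArg star hHv
        rwa [star_mulVec, hH.eq, star_smul,
          star_trivial (hH.eigenvalues i)] at this
      rw [add_mulVec, dotProduct_add, ← mulVec_mulVec, hHv, ← mulVec_mulVec,
        dotProduct_mulVec (star v) H, h2, mulVec_smul, dotProduct_smul, smul_dotProduct,
        Complex.real_smul]
      push_cast
      ring
    rw [h, smul_mulVec, dotProduct_smul] at h1
    have := congrArg Complex.re h1
    rw [Complex.re_ofReal_mul, Complex.smul_re] at this
    simpa using this.symm
  have hNv := (Complex.le_def.1 (hN.dotProduct_mulVec_nonneg v)).1
  have hsv := (Complex.le_def.1 (hs.dotProduct_mulVec_nonneg v))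
  simp only [Complex.zero_re, Complex.zero_im] at hNv hsv
  rcases hsv.1.eq_or_lt with h0 | h0
  · have : s *ᵥ v = 0 := (hs.dotProduct_mulVec_zero_iff v).1 (Complex.ext h0.symm hsv.2.symm)
    have h3 := hHv.symm.trans (hker v this)
    exact ((smul_eq_zero.1 h3).resolve_right hv0).ge
  · simp only [Pi.zero_apply]
    nlinarith

theorem exists_lyapunov_diagonal [DecidableEq n] {σ : n → ℝ} (hσ : ∀ k, 0 ≤ σ k)
    {N : W → Matrix n n ℂ} (hN : ∀ w, (N w).PosSemidef)
    (hsum : ∑ w, N w = diagonal (fun k => (σ k : ℂ)) * diagonal (fun k => (σ k : ℂ))) :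
    ∃ H : W → Matrix n n ℂ, (∀ w, (H w).PosSemidef) ∧
      ∑ w, H w = diagonal (fun k => (σ k : ℂ)) ∧
      (∀ w, diagonal (fun k => (σ k : ℂ)) * H w + H w * diagonal (fun k => (σ k : ℂ))
        = (2 : ℝ) • N w) ∧ ∀ w, N w = 0 → H w = 0 := by
  have hdiag : ∀ l, σ l = 0 → ∀ w, N w l l = 0 := by
    intro l hl
    have : ∑ w, N w l l = 0 := by
      rw [← Matrix.sum_apply, hsum]
      simp [hl]
    exact fun w => (Finset.sum_eq_zero_iff_of_nonneg fun w _ => (hN w).diag_nonneg).1 this w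
      (Finset.mem_univ w)
  have hcol : ∀ w k l, σ l = 0 → N w k l = 0 := fun w k l hl =>
    (hN w).apply_eq_zero_of_diag_eq_zero (hdiag l hl w) k
  have hne : ∀ k l, σ l ≠ 0 → (σ k : ℂ) + σ l ≠ 0 := by
    intro k l hl
    have := (hσ l).lt_of_ne' hl
    exact_mod_cast (add_pos_of_nonneg_of_pos (hσ k) this).ne'
  let H w : Matrix n n ℂ := of fun k l => 2 * N w k l / (σ k + σ l)
  have hH : ∀ w, (H w).IsHermitian := by
    intro w
    ext k l
    have := (hN w).1.apply k l
    simp only [RCLike.star_def] at this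
    simp [H, this, add_comm]
  have hly : ∀ w, diagonal (fun k => (σ k : ℂ)) * H w + H w * diagonal (fun k => (σ k : ℂ))
        = (2 : ℝ) • N w := by
    intro w
    ext k l
    simp only [Matrix.add_apply, diagonal_mul, mul_diagonal, H, of_apply, Matrix.smul_apply,
      Complex.real_smul]
    by_cases hl : σ l = 0
    · simp [hcol w k l hl]
    · have := hne k l hl
      field_simp
      push_cast
      ring
  refine ⟨H, fun w => ?_, ?_, hly, ?_⟩
  · refine PosSemidef.of_anticommutator (s := diagonal fun k => (σ k : ℂ)) ?_ (hN w) (hH w)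
      (hly w) ?_
    · exact PosSemidef.diagonal fun k => by simpa using hσ k
    · intro v hv
      ext k
      refine Finset.sum_eq_zero fun l _ => ?_
      by_cases hl : σ l = 0
      · simp [H, hcol w k l hl]
      · have := congrFun hv l
        simp only [mulVec_diagonal, Pi.zero_apply, mul_eq_zero, Complex.ofReal_eq_zero, hl,
          false_or] at this
        simp [this]
  · ext k l
    have := congrFun (congrFun hsum k) l
    rw [Matrix.sum_apply] at this
    simp only [Matrix.sum_apply, H, of_apply, ← Finset.sum_div, ← Finset.mul_sum, this]
    by_cases hkl : k = l
    · subst hkl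
      by_cases hk : σ k = 0
      · simp [hk]
      · have := hne k k hk
        simp only [diagonal_mul_diagonal, diagonal_apply_eq]
        field_simp
        ring
    · simp [diagonal_apply_ne _ hkl]
  · intro w hw
    ext k l
    simp [H, hw]

theorem exists_lyapunov {s : Matrix n n ℂ} (hs : s.PosSemidef) {N : W → Matrix n n ℂ}
    (hN : ∀ w, (N w).PosSemidef) (hsum : ∑ w, N w = s * s) :
    ∃ H : W → Matrix n n ℂ, (∀ w, (H w).PosSemidef) ∧ ∑ w, H w = s ∧
      (∀ w, s * H w + H w * s = (2 : ℝ) • N w) ∧ ∀ w, N w = 0 → H w = 0 := by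
  classical
  obtain ⟨σ, U, hσ, hUU, hUU', rfl⟩ : ∃ (σ : n → ℝ) (U : Matrix n n ℂ), (∀ k, 0 ≤ σ k) ∧
      Uᴴ * U = 1 ∧ U * Uᴴ = 1 ∧ s = U * diagonal (fun k => (σ k : ℂ)) * Uᴴ :=
    ⟨hs.1.eigenvalues, hs.1.eigenvectorUnitary.1, hs.eigenvalues_nonneg,
      Unitary.coe_star_mul_self hs.1.eigenvectorUnitary,
      Unitary.coe_mul_star_self hs.1.eigenvectorUnitary, hs.1.spectral_theorem⟩
  have hl : ∀ M : Matrix n n ℂ, Uᴴ * (U * M) = M := fun M => by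
    rw [← Matrix.mul_assoc, hUU, Matrix.one_mul]
  have hr : ∀ M : Matrix n n ℂ, U * (Uᴴ * M) = M := fun M => by
    rw [← Matrix.mul_assoc, hUU', Matrix.one_mul]
  obtain ⟨H, hH, hH1, hHly, hH0⟩ := exists_lyapunov_diagonal hσ
    (N := fun w => Uᴴ * N w * U) (fun w => (hN w).conjTranspose_mul_mul_same U) (by
      rw [← Finset.sum_mul, ← Finset.mul_sum, hsum]
      simp only [Matrix.mul_assoc, hl, hUU, Matrix.mul_one])
  refine ⟨fun w => U * H w * Uᴴ, fun w => (hH w).mul_mul_conjTranspose_same U, ?_, fun w => ?_,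
    fun w hw => ?_⟩
  · rw [← Finset.sum_mul, ← Finset.mul_sum, hH1]
  · have := congrArg (fun M => U * M * Uᴴ) (hHly w)
    simp only [Matrix.mul_add, Matrix.add_mul, Matrix.mul_smul, Matrix.smul_mul,
      Matrix.mul_assoc, hl, hr, hUU', Matrix.mul_one] at this ⊢
    exact this
  · simp [hH0 w (by simp [hw])]

theorem Matrix.PosSemidef.exists_sqrt {M : Matrix n n ℂ} (hM : M.PosSemidef) :
    ∃ s : Matrix n n ℂ, s.PosSemidef ∧ s * s = M := by
  classical
  open scoped MatrixOrder in
  exact ⟨CFC.sqrt M, nonneg_iff_posSemidef.1 (CFC.sqrt_nonneg M),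
    CFC.sqrt_mul_sqrt_self M (nonneg_iff_posSemidef.2 hM)⟩

end Lyapunov

section Rounding
variable {n X Y : Type*} [Fintype n] [Fintype X] [Fintype Y]

theorem reTr_mul_eq_of_anticommutator {P H s N : Matrix n n ℂ} (hP : P.IsHermitian)
    (hH : H.IsHermitian) (hs : s.IsHermitian) (h : s * H + H * s = (2 : ℝ) • N) :
    reTr (P * H * s) = reTr (P * N) := by
  have h1 : reTr (P * (s * H)) = reTr (P * (H * s)) := by
    rw [← reTr_conjTranspose, conjTranspose_mul, conjTranspose_mul, hP.eq, hH.eq, hs.eq,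
      reTr_mul_comm]
  have h2 := congrArg (fun M => reTr (P * M)) h
  simp only [Matrix.mul_add, map_add, Matrix.mul_smul, map_smul, smul_eq_mul] at h2
  rw [Matrix.mul_assoc]
  linarith

variable [DecidableEq n]

theorem rounding_inequality {A : X → Matrix n n ℂ} {B : Y → Matrix n n ℂ}
    {N : X × Y → Matrix n n ℂ} {s : Matrix n n ℂ} (hA : ∀ x, (A x).PosSemidef)
    (hA1 : ∑ x, A x = 1) (hB : ∀ y, (B y).PosSemidef) (hB1 : ∑ y, B y = 1)
    (hs : s.PosSemidef) (hs1 : reTr (s * s) = 1) (hN : ∀ w, (N w).PosSemidef)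
    (hsum : ∑ w, N w = s * s) (R : X × Y → Prop) [DecidablePred R]
    (hR : ∀ w, ¬ R w → N w = 0) :
    (∑ w, reTr ((A w.1 + B w.2) * N w)) ^ 2 / 2 - 1
      ≤ ∑ w, if R w then reTr (A w.1 * s * B w.2 * s) else 0 := by
  obtain ⟨H, hH, hHs, hHly, hH0⟩ := exists_lyapunov hs hN hsum
  set F := ∑ w, reTr ((A w.1 + B w.2) * N w) with hF
  have hq : 0 ≤ ∑ w, if R w then reTr (A w.1 * s * B w.2 * s) else 0 :=
    Finset.sum_nonneg fun w _ => by
      split_ifs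
      exacts [reTr_sandwich_nonneg (hA _) (hB _) hs.1, le_rfl]
  have hF0 : 0 ≤ F := Finset.sum_nonneg fun w _ => reTr_mul_nonneg ((hA _).add (hB _)) (hN w)
  rcases lt_or_ge F 1 with hF1 | hF1
  · nlinarith
  have hFs : ∑ w, reTr ((A w.1 + B w.2) * H w * s) = F :=
    Finset.sum_congr rfl fun w _ => reTr_mul_eq_of_anticommutator ((hA _).add (hB _)).1 (hH w).1
      hs.1 (hHly w)
  have hmask := masked_inequality hA hA1 hB hB1 hH hHs (ν := 1 - F / 2) (by linarith)
  rw [hFs, hs1] at hmask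
  have hround : 2 * ∑ w, reTr (s * A w.1 * H w * B w.2)
      - ∑ w, reTr (A w.1 * H w * B w.2 * H w)
      ≤ ∑ w, if R w then reTr (A w.1 * s * B w.2 * s) else 0 := by
    rw [Finset.mul_sum, ← Finset.sum_sub_distrib]
    refine Finset.sum_le_sum fun w _ => ?_
    split_ifs with hw
    · have h1 := reTr_sandwich_nonneg (hA w.1) (hB w.2) (hs.1.sub (hH w).1)
      have h2 : reTr (A w.1 * H w * B w.2 * s) = reTr (s * A w.1 * H w * B w.2) := by
        rw [reTr_mul_comm]
        simp only [Matrix.mul_assoc]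
      have h3 : reTr (A w.1 * s * B w.2 * H w) = reTr (s * A w.1 * H w * B w.2) := by
        rw [← reTr_conjTranspose]
        simp only [conjTranspose_mul, (hA _).1.eq, (hB _).1.eq, (hH w).1.eq, hs.1.eq]
        rw [← Matrix.mul_assoc, reTr_mul_comm]
        simp only [Matrix.mul_assoc]
      simp only [Matrix.mul_sub, Matrix.sub_mul, map_sub, h2, h3] at h1
      linarith
    · simp [hH0 w (hR w hw)]
  nlinarith

theorem local_bound {A : X → Matrix n n ℂ} {B : Y → Matrix n n ℂ} {C : X × Y → Matrix n n ℂ}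
    {K s : Matrix n n ℂ} (hA : ∀ x, (A x).PosSemidef) (hA1 : ∑ x, A x = 1)
    (hB : ∀ y, (B y).PosSemidef) (hB1 : ∑ y, B y = 1) (hC : ∀ w, (C w).PosSemidef)
    (hC1 : ∑ w, C w = 1) (hs : s.PosSemidef) (hsK : s * s = K * Kᴴ)
    (hK : reTr (K * Kᴴ) = 1) (R : X × Y → Prop) [DecidablePred R] :
    (∑ w, if R w then reTr ((A w.1 + B w.2) * (K * C w * Kᴴ)) else 0) ^ 2 / 2 - 1
      ≤ ∑ w, if R w then reTr (A w.1 * s * B w.2 * s) else 0 := by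
  classical
  by_cases hex : ∃ w, R w
  · obtain ⟨w₀, hw₀⟩ := hex
    let D w := (if R w then C w else 0) + if w = w₀ then ∑ w', (if R w' then 0 else C w') else 0
    have hrest : (∑ w', (if R w' then 0 else C w')).PosSemidef :=
      posSemidef_sum _ fun w _ => by
        split_ifs
        exacts [PosSemidef.zero, hC w]
    have hD : ∀ w, (D w).PosSemidef := fun w => by
      refine PosSemidef.add ?_ ?_ <;> split_ifs
      exacts [hC w, PosSemidef.zero, hrest, PosSemidef.zero]
    have hD1 : ∑ w, D w = 1 := by
      rw [← hC1]
      simp only [D, Finset.sum_add_distrib, Finset.sum_ite_eq', Finset.mem_univ, if_true]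
      rw [← Finset.sum_add_distrib]
      exact Finset.sum_congr rfl fun w _ => by split_ifs <;> simp
    have hround := rounding_inequality hA hA1 hB hB1 hs (hsK ▸ hK)
      (N := fun w => K * D w * Kᴴ) (fun w => (hD w).mul_mul_conjTranspose_same K)
      (by rw [← Finset.sum_mul, ← Finset.mul_sum, hD1, Matrix.mul_one, hsK]) R (by
        intro w hw
        have : w ≠ w₀ := fun h => hw (h ▸ hw₀)
        simp [D, hw, this])
    have hnonneg : 0 ≤ ∑ w, if R w then reTr ((A w.1 + B w.2) * (K * C w * Kᴴ)) else 0 :=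
      Finset.sum_nonneg fun w _ => by
        split_ifs
        exacts [reTr_mul_nonneg ((hA _).add (hB _)) ((hC w).mul_mul_conjTranspose_same K), le_rfl]
    have hle : (∑ w, if R w then reTr ((A w.1 + B w.2) * (K * C w * Kᴴ)) else 0)
        ≤ ∑ w, reTr ((A w.1 + B w.2) * (K * D w * Kᴴ)) := by
      refine Finset.sum_le_sum fun w _ => ?_
      have hAB := (hA w.1).add (hB w.2)
      split_ifs with hw
      · have : (if w = w₀ then ∑ w', (if R w' then 0 else C w') else 0).PosSemidef := by
          split_ifs
          exacts [hrest, PosSemidef.zero]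
        have := reTr_mul_nonneg hAB (this.mul_mul_conjTranspose_same K)
        simp only [D, hw, if_true, Matrix.mul_add _ (C w), Matrix.add_mul (K * C w), map_add,
          Matrix.mul_add _ (K * C w * Kᴴ)]
        linarith
      · exact reTr_mul_nonneg hAB ((hD w).mul_mul_conjTranspose_same K)
    have := pow_le_pow_left₀ hnonneg hle 2
    linarith
  · push Not at hex
    simp [hex]

end Rounding

section Strategies

theorem braket_kronecker_re {d : ℕ} (P Q : Mat d) (hQ : Q.IsHermitian)
    (ψ : Fin d × Fin d → ℂ) (K : Mat d) (hK : ∀ k l, K k l = starRingEnd ℂ (ψ (k, l))) :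
    (braket ψ (mconj P ⊗ₖ Q)).re = reTr (P * (K * Q * Kᴴ)) := by
  have h : starRingEnd ℂ (braket ψ (mconj P ⊗ₖ Q)) = (P * (K * Q * Kᴴ)).trace := by
    simp only [braket, dotProduct, mulVec, Fintype.sum_prod_type, kroneckerMap_apply, mconj,
      map_apply, trace, diag_apply, mul_apply, conjTranspose_apply, hK, map_sum, map_mul,
      Pi.star_apply, RCLike.star_def, Complex.conj_conj, Finset.mul_sum, Finset.sum_mul]
    refine Finset.sum_congr rfl fun i _ => ?_
    rw [Finset.sum_comm]
    refine Finset.sum_congr rfl fun k _ => Finset.sum_congr rfl fun j _ =>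
      Finset.sum_congr rfl fun l _ => ?_
    have := hQ.apply l j
    rw [← this, RCLike.star_def]
    ring
  rw [reTr_apply, ← h, Complex.conj_re]

theorem enormSq_eq_reTr {d : ℕ} (ψ : Fin d × Fin d → ℂ) (K : Mat d)
    (hK : ∀ k l, K k l = starRingEnd ℂ (ψ (k, l))) : enormSq ψ = reTr (K * Kᴴ) := by
  simp only [enormSq, Fintype.sum_prod_type, reTr_apply, trace, diag_apply, mul_apply,
    conjTranspose_apply, hK, RCLike.star_def, Complex.conj_conj, Complex.re_sum,
    ← Complex.normSq_eq_conj_mul_self, Complex.ofReal_re]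

/-- Turn a measurement with outcomes in `X ⊕ Y` into one with outcomes in `X`, reporting `x₀`
for the outcomes in `Y`. -/
def mergeOutcomes {n X Y : Type*} [Fintype Y] [DecidableEq X] (A : X ⊕ Y → Matrix n n ℂ)
    (x₀ x : X) : Matrix n n ℂ :=
  A (Sum.inl x) + if x = x₀ then ∑ y, A (Sum.inr y) else 0

theorem mergeOutcomes_sub_posSemidef {n X Y : Type*} [Fintype Y] [DecidableEq X]
    {A : X ⊕ Y → Matrix n n ℂ} (hA : ∀ z, (A z).PosSemidef) (x₀ x : X) :
    (mergeOutcomes A x₀ x - A (Sum.inl x)).PosSemidef := by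
  rw [mergeOutcomes, add_sub_cancel_left]
  split_ifs
  exacts [posSemidef_sum _ fun y _ => hA _, PosSemidef.zero]

theorem isPOVM_mergeOutcomes {d : ℕ} {X Y : Type*} [Fintype X] [Fintype Y] [DecidableEq X]
    {A : X ⊕ Y → Mat d} (hA : IsPOVM A) (x₀ : X) : IsPOVM (mergeOutcomes A x₀) := by
  refine ⟨fun x => ?_, ?_⟩
  · have := (hA.1 (Sum.inl x)).add (mergeOutcomes_sub_posSemidef hA.1 x₀ x)
    rwa [add_sub_cancel] at this
  · rw [← hA.2, Fintype.sum_sum_type]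
    simp [mergeOutcomes, Finset.sum_add_distrib]

theorem IsPOVM.comp_equiv {d : ℕ} {X Y : Type*} [Fintype X] [Fintype Y] {A : X → Mat d}
    (hA : IsPOVM A) (e : Y ≃ X) : IsPOVM fun y => A (e y) :=
  ⟨fun y => hA.1 (e y), by rw [← hA.2]; exact e.sum_comp A⟩

end Strategies

namespace Game

variable (G : Game)

theorem pay_le_one {d : ℕ} {A : G.U → G.A → Mat d} {B : G.V → G.B → Mat d}
    {ψ : Fin d × Fin d → ℂ} (hA : G.IsStrategyA A) (hB : G.IsStrategyB B)
    (hψ : enormSq ψ = 1) : G.pay A B ψ ≤ 1 := by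
  set K : Mat d := of fun k l => starRingEnd ℂ (ψ (k, l)) with hK
  rw [enormSq_eq_reTr ψ K fun _ _ => rfl] at hψ
  calc G.pay A B ψ ≤ ∑ u, ∑ v, G.μ u v * 1 := by
        refine Finset.sum_le_sum fun u _ => Finset.sum_le_sum fun v _ =>
          mul_le_mul_of_nonneg_left ?_ (G.μ_nonneg u v)
        have hsum : ∑ a, ∑ b, reTr (A u a * (K * B v b * Kᴴ)) = 1 := by
          simp only [← map_sum, ← Finset.mul_sum, ← Finset.sum_mul, (hA u).2, (hB v).2,
            Matrix.mul_one, Matrix.one_mul, hψ]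
        rw [← hsum]
        refine Finset.sum_le_sum fun a _ => Finset.sum_le_sum fun b _ => ?_
        rw [braket_kronecker_re _ _ ((hB v).1 b).1 ψ K fun _ _ => rfl]
        have := reTr_mul_nonneg ((hA u).1 a) (((hB v).1 b).mul_mul_conjTranspose_same K)
        split_ifs
        exacts [le_rfl, this]
    _ = 1 := by simp [G.μ_sum]

theorem pay_nonneg {d : ℕ} {A : G.U → G.A → Mat d} {B : G.V → G.B → Mat d}
    {ψ : Fin d × Fin d → ℂ} (hA : G.IsStrategyA A) (hB : G.IsStrategyB B) :
    0 ≤ G.pay A B ψ := by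
  refine Finset.sum_nonneg fun u _ => Finset.sum_nonneg fun v _ =>
    mul_nonneg (G.μ_nonneg u v) (Finset.sum_nonneg fun a _ => Finset.sum_nonneg fun b _ => ?_)
  rw [braket_kronecker_re _ _ ((hB v).1 b).1 ψ (of fun k l => starRingEnd ℂ (ψ (k, l)))
    fun _ _ => rfl]
  split_ifs
  exacts [reTr_mul_nonneg ((hA u).1 a) (((hB v).1 b).mul_mul_conjTranspose_same _), le_rfl]

theorem pay_le_entVal {d : ℕ} {A : G.U → G.A → Mat d} {B : G.V → G.B → Mat d}
    {ψ : Fin d × Fin d → ℂ} (hA : G.IsStrategyA A) (hB : G.IsStrategyB B)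
    (hψ : enormSq ψ = 1) : G.pay A B ψ ≤ G.entVal := by
  refine le_csSup ⟨1, ?_⟩ ⟨d, A, B, ψ, hA, hB, hψ, rfl⟩
  rintro _ ⟨d, A, B, ψ, hA, hB, hψ, rfl⟩
  exact G.pay_le_one hA hB hψ

/-- The payoff in the projection game, as an average over the question pairs of `G`. -/
theorem toProj_pay_eq {d : ℕ} {A : G.U ⊕ G.V → G.A ⊕ G.B → Mat d}
    {C : G.U × G.V → G.A × G.B → Mat d} {ψ : Fin d × Fin d → ℂ} (K : Mat d)
    (hK : ∀ k l, K k l = starRingEnd ℂ (ψ (k, l))) (hC : ∀ p, IsPOVM (C p)) :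
    G.toProj.pay A C ψ = ∑ u, ∑ v, G.μ u v * ((∑ w : G.A × G.B, if G.Acc u v w.1 w.2 then
      reTr ((A (Sum.inl u) (Sum.inl w.1) + A (Sum.inr v) (Sum.inr w.2))
        * (K * C (u, v) w * Kᴴ)) else 0) / 2) := by
  let _ : ∀ (q : G.U ⊕ G.V) (p : G.U × G.V) (x : G.A ⊕ G.B) (y : G.A × G.B),
    Decidable (G.toProj.Acc q p x y) := G.toProj.dAcc
  have hre : ∀ (P : Mat d) (u v w), (braket ψ (mconj P ⊗ₖ C (u, v) w)).re
      = reTr (P * (K * C (u, v) w * Kᴴ)) :=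
    fun P u v w => braket_kronecker_re _ _ ((hC (u, v)).1 w).1 ψ K hK
  have hl : ∀ u u' v, (∑ x : G.A ⊕ G.B, ∑ y : G.A × G.B,
      if G.toProj.Acc (Sum.inl u) (u', v) x y then
        (braket ψ (mconj (A (Sum.inl u) x) ⊗ₖ C (u', v) y)).re else 0)
      = ∑ w : G.A × G.B, if G.Acc u' v w.1 w.2 then
        reTr (A (Sum.inl u) (Sum.inl w.1) * (K * C (u', v) w * Kᴴ)) else 0 := by
    intro u u' v
    rw [Finset.sum_comm]
    refine Finset.sum_congr rfl fun y _ => ?_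
    simp only [Fintype.sum_sum_type, toProj, hre]
    by_cases h : G.Acc u' v y.1 y.2 <;> simp [h]
  have hr : ∀ v u v', (∑ x : G.A ⊕ G.B, ∑ y : G.A × G.B,
      if G.toProj.Acc (Sum.inr v) (u, v') x y then
        (braket ψ (mconj (A (Sum.inr v) x) ⊗ₖ C (u, v') y)).re else 0)
      = ∑ w : G.A × G.B, if G.Acc u v' w.1 w.2 then
        reTr (A (Sum.inr v) (Sum.inr w.2) * (K * C (u, v') w * Kᴴ)) else 0 := by
    intro v u v'
    rw [Finset.sum_comm]
    refine Finset.sum_congr rfl fun y _ => ?_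
    simp only [Fintype.sum_sum_type, toProj, hre]
    by_cases h : G.Acc u v' y.1 y.2 <;> simp [h]
  calc G.toProj.pay A C ψ
      = ∑ q : G.U ⊕ G.V, ∑ p : G.U × G.V, G.toProj.μ q p *
        ∑ x : G.A ⊕ G.B, ∑ y : G.A × G.B, if G.toProj.Acc q p x y then
          (braket ψ (mconj (A q x) ⊗ₖ C p y)).re else 0 := rfl
    _ = _ := by
      rw [Finset.sum_comm]
      simp only [Fintype.sum_sum_type (α₁ := G.U), Fintype.sum_prod_type (α₁ := G.U), hl, hr]
      refine Finset.sum_congr rfl fun u _ => Finset.sum_congr rfl fun v _ => ?_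
      simp only [toProj, Sum.elim_inl, Sum.elim_inr, ite_mul, zero_mul, Finset.sum_ite_eq',
        Finset.mem_univ, if_true]
      rw [← mul_add, ← Finset.sum_add_distrib, div_mul_eq_mul_div, mul_div_assoc]
      congr 2
      refine Finset.sum_congr rfl fun w _ => ?_
      split_ifs
      · rw [Matrix.add_mul, map_add]
      · exact add_zero 0

theorem toProj_pay_sq_le {d : ℕ} {A : G.U ⊕ G.V → G.A ⊕ G.B → Mat d}
    {C : G.U × G.V → G.A × G.B → Mat d} {ψ : Fin d × Fin d → ℂ} (hA : ∀ q, IsPOVM (A q))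
    (hC : ∀ p, IsPOVM (C p)) (hψ : enormSq ψ = 1) (a₀ : G.A) (b₀ : G.B) :
    ∃ (A' : G.U → G.A → Mat d) (B' : G.V → G.B → Mat d) (φ : Fin d × Fin d → ℂ),
      G.IsStrategyA A' ∧ G.IsStrategyB B' ∧ enormSq φ = 1 ∧
      G.toProj.pay A C ψ ^ 2 ≤ (1 + G.pay A' B' φ) / 2 := by
  set K : Mat d := of fun k l => starRingEnd ℂ (ψ (k, l)) with hKdef
  have hK : ∀ k l, K k l = starRingEnd ℂ (ψ (k, l)) := fun _ _ => rfl
  rw [enormSq_eq_reTr ψ K hK] at hψ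
  obtain ⟨s, hs, hsK⟩ := (posSemidef_self_mul_conjTranspose K).exists_sqrt
  let φ : Fin d × Fin d → ℂ := fun p => starRingEnd ℂ (s p.1 p.2)
  have hφ : ∀ k l, s k l = starRingEnd ℂ (φ (k, l)) := fun _ _ => (Complex.conj_conj _).symm
  let A' u := mergeOutcomes (A (Sum.inl u)) a₀
  let B' v := mergeOutcomes (fun z => A (Sum.inr v) (Equiv.sumComm G.B G.A z)) b₀
  have hA' : ∀ u, IsPOVM (A' u) := fun u => isPOVM_mergeOutcomes (hA _) a₀
  have hB' : ∀ v, IsPOVM (B' v) := fun v => isPOVM_mergeOutcomes ((hA _).comp_equiv _) b₀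
  refine ⟨A', B', φ, hA', hB', by rw [enormSq_eq_reTr φ s hφ, hs.1.eq, hsK, hψ], ?_⟩
  let p u v := ∑ w : G.A × G.B, if G.Acc u v w.1 w.2 then
    reTr ((A' u w.1 + B' v w.2) * (K * C (u, v) w * Kᴴ)) else 0
  let q u v := ∑ w : G.A × G.B, if G.Acc u v w.1 w.2 then
    reTr (A' u w.1 * s * B' v w.2 * s) else 0
  have hpq : ∀ u v, p u v ^ 2 / 2 - 1 ≤ q u v := fun u v =>
    local_bound (hA' u).1 (hA' u).2 (hB' v).1 (hB' v).2 (hC (u, v)).1 (hC (u, v)).2 hs hsK hψ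
      fun w => G.Acc u v w.1 w.2
  have hpay : G.pay A' B' φ = ∑ u, ∑ v, G.μ u v * q u v := by
    refine Finset.sum_congr rfl fun u _ => Finset.sum_congr rfl fun v _ => ?_
    simp only [q, Fintype.sum_prod_type]
    congr 1
    refine Finset.sum_congr rfl fun a _ => Finset.sum_congr rfl fun b _ => ?_
    rw [braket_kronecker_re _ _ ((hB' v).1 b).1 φ s hφ, hs.1.eq]
    simp only [Matrix.mul_assoc]
  have hproj : G.toProj.pay A C ψ ≤ ∑ u, ∑ v, G.μ u v * (p u v / 2) := by
    rw [G.toProj_pay_eq K hK hC]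
    refine Finset.sum_le_sum fun u _ => Finset.sum_le_sum fun v _ =>
      mul_le_mul_of_nonneg_left ?_ (G.μ_nonneg u v)
    refine div_le_div_of_nonneg_right (Finset.sum_le_sum fun w _ => ?_) two_pos.le
    split_ifs
    · have h1 : ((A' u w.1 - A (Sum.inl u) (Sum.inl w.1)) +
          (B' v w.2 - A (Sum.inr v) (Sum.inr w.2))).PosSemidef :=
        (mergeOutcomes_sub_posSemidef (hA (Sum.inl u)).1 a₀ w.1).add
          (mergeOutcomes_sub_posSemidef (fun z => (hA (Sum.inr v)).1 _) b₀ w.2)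
      have h2 := reTr_mul_nonneg h1 (((hC (u, v)).1 w).mul_mul_conjTranspose_same K)
      simp only [Matrix.add_mul, Matrix.sub_mul, map_add, map_sub] at h2 ⊢
      linarith
    · exact le_rfl
  set c := G.toProj.pay A C ψ with hc
  have hc0 : 0 ≤ c := G.toProj.pay_nonneg hA hC
  have hsum : ∑ u, ∑ v, G.μ u v * (c * p u v - 2 * c ^ 2)
      ≤ ∑ u, ∑ v, G.μ u v * ((1 + q u v) / 2 - c ^ 2) :=
    Finset.sum_le_sum fun u _ => Finset.sum_le_sum fun v _ =>
      mul_le_mul_of_nonneg_left (by nlinarith [hpq u v, sq_nonneg (p u v / 2 - c)])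
        (G.μ_nonneg u v)
  have hl : ∑ u, ∑ v, G.μ u v * (c * p u v - 2 * c ^ 2)
      = 2 * c * ∑ u, ∑ v, G.μ u v * (p u v / 2) - 2 * c ^ 2 := by
    have h := congrArg (2 * c ^ 2 * ·) G.μ_sum
    have h' : 2 * c * ∑ u, ∑ v, G.μ u v * (p u v / 2) - 2 * c ^ 2
      = 2 * c * ∑ u, ∑ v, G.μ u v * (p u v / 2) - 2 * c ^ 2 * 1 := by rw [mul_one]
    simp only [Finset.mul_sum] at h h' ⊢
    rw [h', ← h]
    simp only [← Finset.sum_sub_distrib]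
    exact Finset.sum_congr rfl fun u _ => Finset.sum_congr rfl fun v _ => by ring
  have hr : ∑ u, ∑ v, G.μ u v * ((1 + q u v) / 2 - c ^ 2)
      = (1 + G.pay A' B' φ) / 2 - c ^ 2 := by
    have h := congrArg ((1 / 2 - c ^ 2) * ·) G.μ_sum
    have h' : (1 + G.pay A' B' φ) / 2 - c ^ 2
      = (1 / 2 - c ^ 2) * 1 + 1 / 2 * ∑ u, ∑ v, G.μ u v * q u v := by rw [hpay]; ring
    simp only [Finset.mul_sum] at h h' ⊢
    rw [h', ← h]
    simp only [← Finset.sum_add_distrib]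
    exact Finset.sum_congr rfl fun u _ => Finset.sum_congr rfl fun v _ => by ring
  nlinarith [mul_le_mul_of_nonneg_left hproj hc0]

end Game

/-- Entangled values of a game and of its associated projection game:
`val*(G') ≤ √((1 + val*(G))/2)`. -/
theorem entVal_toProj (G : Game) :
    G.toProj.entVal ≤ Real.sqrt ((1 + G.entVal) / 2) := by
  refine Real.sSup_le ?_ (Real.sqrt_nonneg _)
  rintro _ ⟨d, A, C, ψ, hA, hC, hψ, rfl⟩
  by_cases hne : Nonempty G.A ∧ Nonempty G.B
  · obtain ⟨⟨a₀⟩, ⟨b₀⟩⟩ := hne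
    obtain ⟨A', B', φ, hA', hB', hφ, hle⟩ := G.toProj_pay_sq_le hA hC hψ a₀ b₀
    refine Real.le_sqrt_of_sq_le (hle.trans ?_)
    have := G.pay_le_entVal hA' hB' hφ
    linarith
  · have : IsEmpty G.toProj.B := by
      rw [not_and_or, not_nonempty_iff, not_nonempty_iff] at hne
      exact isEmpty_prod.2 hne
    have h0 : G.toProj.pay A C ψ = 0 := by simp [Game.pay]
    rw [h0]
    exact Real.sqrt_nonneg _
end
end

section
/- There is a universal constant C₀ > 0 such that the following holds. Let V be a finite set, ν a symmetric probability distribution on V×V with marginal ν(v), and η > 0. Let p_1,…,p_d be nonnegative reals with Σ_i p_i = 1, ρ := diag(p_1,…,p_d), and Φ := Σ_{i=1}^d √(p_i) e_i⊗e_i ∈ ℂ^d⊗ℂ^d. For each v ∈ V let A_v be Hermitian with 0 ≤ A_v ≤ Id, and let U_v be a unitary such that U_v A_v^{1/2} ρ^{1/4} = ρ^{1/4} A_v^{1/2} U_v† = (ρ^{1/4} A_v ρ^{1/4})^{1/2}. Define Φ_{vv'} := (conj(U_v) conj(A_v)^{1/2} ⊗ U_{v'} A_{v'}^{1/2}) Φ.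 Suppose Σ_{(v,v')} ν(v,v') ⟨Φ| conj(A_v) ⊗ A_{v'} |Φ⟩ ≥ (1 − η) Σ_v ν(v) ⟨Φ| conj(A_v) ⊗ A_v |Φ⟩. Then: (i) for every v'' ∈ V, Σ_{(v,v')} ν(v,v') ‖Φ_{vv''} − Φ_{v'v''}‖² ≤ C₀ η^{1/2} (Σ_v ν(v) ‖Φ_{vv}‖²)^{1/2} ‖Φ_{v''v''}‖; and (ii) Σ_{(v,v')} ν(v,v') ‖Φ_{vv} − Φ_{v'v}‖² ≤ C₀ η^{1/2} Σ_v ν(v) ‖Φ_{vv}‖². -/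
noncomputable section
open scoped Kronecker ComplexOrder
open Matrix

/-- The state `Σ_i √(p_i) e_i ⊗ e_i` in `ℂ^d ⊗ ℂ^d`. -/
def diagState {d : ℕ} (p : Fin d → ℝ) : Fin d × Fin d → ℂ :=
  fun q => if q.1 = q.2 then (Real.sqrt (p q.1) : ℂ) else 0

/-- The post-measurement states `Φ_{vv'} = (conj(U_v) conj(A_v)^{1/2} ⊗ U_{v'} A_{v'}^{1/2}) Φ`,
where `Φ = diagState p` and `sqA v = A_v^{1/2}`. -/
def phiVV {V : Type*} {d : ℕ} (p : Fin d → ℝ) (sqA U : V → Mat d) (v v' : V) :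
    Fin d × Fin d → ℂ :=
  ((mconj (U v) * mconj (sqA v)) ⊗ₖ (U v' * sqA v')).mulVec (diagState p)

open scoped MatrixOrder Matrix.Norms.L2Operator in
/-- A positive semidefinite matrix has a unique positive semidefinite square root. -/
lemma Matrix.PosSemidef.eq_of_mul_self_eq_mul_self {n : Type*} [Fintype n] [DecidableEq n]
    {A B : Matrix n n ℂ} (hA : A.PosSemidef) (hB : B.PosSemidef) (h : A * A = B * B) : A = B :=
  (CFC.mul_self_eq_mul_self_iff A B hA.nonneg hB.nonneg).mp h

section HilbertSchmidt

variable {n : Type*} [Fintype n]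

/-- The squared Hilbert–Schmidt norm of a complex matrix. -/
def hsNormSq (M : Matrix n n ℂ) : ℝ := ∑ i, ∑ j, Complex.normSq (M i j)

lemma hsNormSq_nonneg (M : Matrix n n ℂ) : 0 ≤ hsNormSq M :=
  Finset.sum_nonneg fun _ _ => Finset.sum_nonneg fun _ _ => Complex.normSq_nonneg _

lemma hsNormSq_eq_re_trace (M : Matrix n n ℂ) : hsNormSq M = (Mᴴ * M).trace.re := by
  simp only [hsNormSq, Matrix.trace, Matrix.diag, Matrix.mul_apply, Complex.re_sum,
    Matrix.conjTranspose_apply]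
  rw [Finset.sum_comm]
  refine Finset.sum_congr rfl fun i _ => Finset.sum_congr rfl fun j _ => ?_
  simp [Complex.normSq_apply]

/-- The Cauchy–Schwarz inequality for the Hilbert–Schmidt inner product. -/
lemma re_trace_mul_le (P Q : Matrix n n ℂ) :
    (P * Q).trace.re ≤ Real.sqrt (hsNormSq P) * Real.sqrt (hsNormSq Q) := by
  have hQ : hsNormSq Q = ∑ x : n × n, ‖Q x.2 x.1‖ ^ 2 := by
    rw [Fintype.sum_prod_type, Finset.sum_comm]
    simp [hsNormSq, Complex.normSq_eq_norm_sq]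
  have hP : hsNormSq P = ∑ x : n × n, ‖P x.1 x.2‖ ^ 2 := by
    rw [Fintype.sum_prod_type]
    simp [hsNormSq, Complex.normSq_eq_norm_sq]
  rw [hP, hQ]
  refine le_trans ?_ (Real.sum_mul_le_sqrt_mul_sqrt _ _ _)
  simp only [Matrix.trace, Matrix.diag, Matrix.mul_apply, Complex.re_sum]
  rw [Fintype.sum_prod_type]
  refine Finset.sum_le_sum fun i _ => Finset.sum_le_sum fun j _ => ?_
  exact (Complex.re_le_norm _).trans (norm_mul _ _).le

lemma hsNormSq_sub {P Q : Matrix n n ℂ} (hP : P.IsHermitian) (hQ : Q.IsHermitian) :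
    hsNormSq (P - Q) = hsNormSq P + hsNormSq Q - 2 * (P * Q).trace.re := by
  simp only [hsNormSq_eq_re_trace, Matrix.conjTranspose_sub, hP.eq, hQ.eq, sub_mul, mul_sub,
    Matrix.trace_sub, Complex.sub_re, Matrix.trace_mul_comm Q P]
  ring

/-- For Hermitian `T` and `D`, the squared Hilbert–Schmidt norm of `T * D` is `Tr (T ^ 2 * D ^ 2)`. -/
lemma hsNormSq_mul {T D : Matrix n n ℂ} (hT : T.IsHermitian) (hD : D.IsHermitian) :
    hsNormSq (T * D) = ((T * T) * (D * D)).trace.re := by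
  rw [hsNormSq_eq_re_trace, Matrix.conjTranspose_mul, hT.eq, hD.eq, Matrix.mul_assoc,
    Matrix.trace_mul_comm]
  simp only [Matrix.mul_assoc]

variable [DecidableEq n]

lemma hsNormSq_unitary_conj {W : Matrix n n ℂ} (hW : W * Wᴴ = 1) (M : Matrix n n ℂ) :
    hsNormSq (Wᴴ * M * W) = hsNormSq M := by
  have h : (Wᴴ * M * W)ᴴ * (Wᴴ * M * W) = Wᴴ * (Mᴴ * M * W) := by
    calc _ = Wᴴ * Mᴴ * (W * Wᴴ) * M * W := by
          simp [Matrix.conjTranspose_mul, Matrix.mul_assoc]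
      _ = _ := by rw [hW]; simp [Matrix.mul_assoc]
  rw [hsNormSq_eq_re_trace, h, Matrix.trace_mul_comm, Matrix.mul_assoc, hW, Matrix.mul_one,
    hsNormSq_eq_re_trace]

lemma hsNormSq_mul_self_le_of_sub_eq_diagonal {A B : Matrix n n ℂ} (hA : A.PosSemidef)
    (hB : B.PosSemidef) {δ : n → ℝ} (h : A - B = Matrix.diagonal fun i => (δ i : ℂ)) :
    hsNormSq ((A - B) * (A - B)) ≤ hsNormSq (A * A - B * B) := by
  have hentry : ∀ i, (A * A - B * B) i i = δ i * (A i i + B i i) := by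
    intro i
    have e : A * A - B * B = (A - B) * A + B * (A - B) := by noncomm_ring
    rw [e, h]
    simp [Matrix.diagonal_mul, Matrix.mul_diagonal]
    ring
  have hleft : hsNormSq ((A - B) * (A - B)) = ∑ i, δ i ^ 4 := by
    rw [h, Matrix.diagonal_mul_diagonal]
    refine Finset.sum_congr rfl fun i _ => ?_
    rw [Finset.sum_eq_single i]
    · rw [Matrix.diagonal_apply_eq, Complex.normSq_mul, Complex.normSq_ofReal]
      ring
    · intro j _ hj
      simp [Matrix.diagonal_apply_ne' _ hj]
    · simp
  rw [hleft]
  refine Finset.sum_le_sum fun i _ => ?_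
  refine le_trans ?_ (Finset.single_le_sum (f := fun j => Complex.normSq ((A * A - B * B) i j))
    (fun _ _ => Complex.normSq_nonneg _) (Finset.mem_univ i))
  obtain ⟨ha, ha'⟩ := Complex.nonneg_iff.mp (hA.diag_nonneg (i := i))
  obtain ⟨hb, hb'⟩ := Complex.nonneg_iff.mp (hB.diag_nonneg (i := i))
  have hd : (A i i).re - (B i i).re = δ i := by
    have := congrArg (fun M : Matrix n n ℂ => (M i i).re) h
    simpa using this
  simp only [hentry, Complex.normSq_mul, Complex.normSq_ofReal]
  have h2 : δ i ^ 2 ≤ Complex.normSq (A i i + B i i) := by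
    rw [Complex.normSq_apply, Complex.add_re, Complex.add_im, ← ha', ← hb', ← hd]
    nlinarith [mul_nonneg ha hb]
  nlinarith [sq_nonneg (δ i)]

/-- For positive semidefinite `A`, `B`, the Hilbert–Schmidt norm of `(A - B) ^ 2` is at most that
of `A ^ 2 - B ^ 2`. -/
lemma hsNormSq_sub_mul_self_le {A B : Matrix n n ℂ} (hA : A.PosSemidef) (hB : B.PosSemidef) :
    hsNormSq ((A - B) * (A - B)) ≤ hsNormSq (A * A - B * B) := by
  have hD : (A - B).IsHermitian := hA.1.sub hB.1
  let W : Matrix n n ℂ := (hD.eigenvectorUnitary).1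
  have hW : W * Wᴴ = 1 := Matrix.mem_unitaryGroup_iff.mp hD.eigenvectorUnitary.2
  have hW' : Wᴴ * W = 1 := Matrix.mem_unitaryGroup_iff'.mp hD.eigenvectorUnitary.2
  have hconj : ∀ M N : Matrix n n ℂ, (Wᴴ * M * W) * (Wᴴ * N * W) = Wᴴ * (M * N) * W := by
    intro M N
    calc _ = Wᴴ * M * (W * Wᴴ) * N * W := by simp only [Matrix.mul_assoc]
      _ = _ := by rw [hW]; simp only [Matrix.mul_assoc, Matrix.one_mul]
  have hsub : ∀ M N : Matrix n n ℂ, Wᴴ * M * W - Wᴴ * N * W = Wᴴ * (M - N) * W := by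
    intro M N
    rw [Matrix.mul_sub, Matrix.sub_mul]
  have hdiag : Wᴴ * A * W - Wᴴ * B * W
      = Matrix.diagonal fun i => (hD.eigenvalues i : ℂ) := by
    have hs : A - B = W * (Matrix.diagonal fun i => (hD.eigenvalues i : ℂ)) * Wᴴ :=
      hD.spectral_theorem
    rw [hsub]
    calc _ = Wᴴ * (W * (Matrix.diagonal fun i => (hD.eigenvalues i : ℂ)) * Wᴴ) * W :=
          congrArg (fun M => Wᴴ * M * W) hs
      _ = (Wᴴ * W) * (Matrix.diagonal fun i => (hD.eigenvalues i : ℂ)) * (Wᴴ * W) := by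
          simp only [Matrix.mul_assoc]
      _ = _ := by rw [hW', Matrix.one_mul, Matrix.mul_one]
  have key := hsNormSq_mul_self_le_of_sub_eq_diagonal (hA.conjTranspose_mul_mul_same W)
    (hB.conjTranspose_mul_mul_same W) hdiag
  rwa [hsub, hconj, hconj, hconj, hsub, hsNormSq_unitary_conj hW, hsNormSq_unitary_conj hW] at key

/-- For positive semidefinite `A`, `B` and Hermitian `T`, the squared Hilbert–Schmidt norm of
`T * (A - B)` is controlled by `T ^ 2` and `A ^ 2 - B ^ 2`. -/
lemma hsNormSq_mul_sub_le {T A B : Matrix n n ℂ} (hT : T.IsHermitian) (hA : A.PosSemidef)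
    (hB : B.PosSemidef) :
    hsNormSq (T * (A - B)) ≤
      Real.sqrt (hsNormSq (T * T)) * Real.sqrt (hsNormSq (A * A - B * B)) := by
  rw [hsNormSq_mul hT (hA.1.sub hB.1)]
  refine (re_trace_mul_le _ _).trans ?_
  gcongr
  exact hsNormSq_sub_mul_self_le hA hB

end HilbertSchmidt

/-- The state `(conj X ⊗ Y) Φ` is the vectorization of `Y ρ^{1/2} X†`. -/
lemma kronecker_mulVec_diagState {d : ℕ} (p : Fin d → ℝ) (X Y : Mat d) (i j : Fin d) :
    ((mconj X ⊗ₖ Y).mulVec (diagState p)) (i, j)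
      = (Y * (Matrix.diagonal fun i => (Real.sqrt (p i) : ℂ)) * Xᴴ) j i := by
  simp only [Matrix.mulVec, dotProduct, Fintype.sum_prod_type, diagState,
    Matrix.mul_apply (N := Xᴴ), Matrix.mul_diagonal, Matrix.kroneckerMap_apply, mconj, Matrix.map_apply,
    Matrix.conjTranspose_apply, mul_ite, mul_zero, Finset.sum_ite_eq, Finset.mem_univ, if_true]
  refine Finset.sum_congr rfl fun k _ => ?_
  simp only [starRingEnd_apply]
  ring

/-- The correlation `⟨Φ| conj X ⊗ Y |Φ⟩` is `Tr (ρ^{1/2} Y ρ^{1/2} X†)`. -/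
lemma braket_diagState {d : ℕ} (p : Fin d → ℝ) (X Y : Mat d) :
    braket (diagState p) (mconj X ⊗ₖ Y)
      = ((Matrix.diagonal fun i => (Real.sqrt (p i) : ℂ)) *
          (Y * (Matrix.diagonal fun i => (Real.sqrt (p i) : ℂ)) * Xᴴ)).trace := by
  rw [braket, dotProduct, Fintype.sum_prod_type]
  simp only [kronecker_mulVec_diagState, Matrix.trace, Matrix.diag, Matrix.diagonal_mul]
  refine Finset.sum_congr rfl fun i _ => ?_
  simp [diagState, apply_ite, ite_mul]

lemma mconj_mul {l m n : Type*} [Fintype m] (M : Matrix l m ℂ) (N : Matrix m n ℂ) :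
    mconj M * mconj N = mconj (M * N) :=
  (Matrix.map_mul (f := starRingEnd ℂ)).symm

/-- The Cauchy–Schwarz inequality for a nonnegative weight on pairs. -/
lemma sum_sum_mul_mul_le_sqrt_mul_sqrt {V : Type*} [Fintype V] {ν : V → V → ℝ}
    (hν : ∀ v w, 0 ≤ ν v w) (a b : V → V → ℝ) :
    ∑ v, ∑ w, ν v w * (a v w * b v w) ≤
      Real.sqrt (∑ v, ∑ w, ν v w * a v w ^ 2) * Real.sqrt (∑ v, ∑ w, ν v w * b v w ^ 2) := by
  have h := Real.sum_mul_le_sqrt_mul_sqrt (Finset.univ : Finset (V × V))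
    (fun x => Real.sqrt (ν x.1 x.2) * a x.1 x.2) (fun x => Real.sqrt (ν x.1 x.2) * b x.1 x.2)
  simp only [mul_pow, Real.sq_sqrt (hν _ _), Fintype.sum_prod_type] at h
  refine le_trans (le_of_eq ?_) h
  refine Finset.sum_congr rfl fun v _ => Finset.sum_congr rfl fun w _ => ?_
  rw [mul_mul_mul_comm, Real.mul_self_sqrt (hν v w)]

/-- **Lemma 4.5.** If the correlation `⟨Φ| conj(A_v) ⊗ A_{v'} |Φ⟩` is `(1−η)`-preserved along
the symmetric distribution `ν`, then the post-measurement states `Φ_{vv'}` are close on average.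
Here `rho4 = ρ^{1/4}`, `sqA v = A_v^{1/2}` and `R v = (ρ^{1/4} A_v ρ^{1/4})^{1/2}` are the unique
positive semidefinite roots, and `U_v` are the unitaries with
`U_v A_v^{1/2} ρ^{1/4} = ρ^{1/4} A_v^{1/2} U_v† = (ρ^{1/4} A_v ρ^{1/4})^{1/2}`. -/
theorem post_measurement_states_close : ∃ C₀ : ℝ, 0 < C₀ ∧
    ∀ (V : Type) [Fintype V] (ν : V → V → ℝ),
      (∀ v v', 0 ≤ ν v v') → (∀ v v', ν v v' = ν v' v) → (∑ v, ∑ v', ν v v' = 1) →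
    ∀ (η : ℝ), 0 < η →
    ∀ (d : ℕ) (p : Fin d → ℝ), (∀ i, 0 ≤ p i) → (∑ i, p i) = 1 →
    ∀ (A sqA U R : V → Mat d) (rho4 : Mat d),
      (∀ v, (A v).PosSemidef ∧ ((1 : Mat d) - A v).PosSemidef) →
      (∀ v, (sqA v).PosSemidef ∧ sqA v * sqA v = A v) →
      rho4.PosSemidef →
      (rho4 * rho4 * (rho4 * rho4) = Matrix.diagonal fun i => (p i : ℂ)) →
      (∀ v, U v ∈ Matrix.unitaryGroup (Fin d) ℂ) →
      (∀ v, (R v).PosSemidef ∧ R v * R v = rho4 * A v * rho4 ∧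
        U v * sqA v * rho4 = R v ∧ rho4 * sqA v * (U v)ᴴ = R v) →
      (1 - η) * (∑ v, (∑ w, ν v w) * (braket (diagState p) (mconj (A v) ⊗ₖ A v)).re)
        ≤ ∑ v, ∑ v', ν v v' * (braket (diagState p) (mconj (A v) ⊗ₖ A v')).re →
      (∀ v'' : V,
        ∑ v, ∑ v', ν v v' * enormSq (phiVV p sqA U v v'' - phiVV p sqA U v' v'')
          ≤ C₀ * Real.sqrt η *
              Real.sqrt (∑ v, (∑ w, ν v w) * enormSq (phiVV p sqA U v v)) *
              Real.sqrt (enormSq (phiVV p sqA U v'' v''))) ∧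
      ∑ v, ∑ v', ν v v' * enormSq (phiVV p sqA U v v - phiVV p sqA U v' v)
        ≤ C₀ * Real.sqrt η * ∑ v, (∑ w, ν v w) * enormSq (phiVV p sqA U v v) := by
  refine ⟨2, by norm_num, ?_⟩
  intro V _ ν hν hsymm hsum η hη d p hp _ A sqA U R rho4 hA _ hrho4 hrho _ hR hcorr
  have hsqrt : rho4 * rho4 = Matrix.diagonal fun i => (Real.sqrt (p i) : ℂ) := by
    refine Matrix.PosSemidef.eq_of_mul_self_eq_mul_self ?_ ?_ ?_
    · simpa [hrho4.1.eq] using Matrix.posSemidef_conjTranspose_mul_self rho4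
    · refine Matrix.PosSemidef.diagonal fun i => ?_
      simp [Real.sqrt_nonneg]
    · rw [hrho, Matrix.diagonal_mul_diagonal]
      congr 1
      ext i
      rw [← Complex.ofReal_mul, Real.mul_self_sqrt (hp i)]
  have hRR : ∀ v, (R v * R v).IsHermitian := fun v => by
    rw [Matrix.IsHermitian, Matrix.conjTranspose_mul, (hR v).1.1.eq]
  have hphi : ∀ v w i j, phiVV p sqA U v w (i, j) = (R w * R v) j i := by
    intro v w i j
    have hRv : rho4 * (U v * sqA v)ᴴ = R v := by
      rw [← (hR v).1.1.eq, ← (hR v).2.2.1, Matrix.conjTranspose_mul _ rho4, hrho4.1.eq]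
    rw [phiVV, mconj_mul, kronecker_mulVec_diagState, ← hsqrt]
    conv_rhs => rw [← hRv, ← (hR w).2.2.1]
    simp only [Matrix.mul_assoc]
  have hdiff : ∀ v v' w, enormSq (phiVV p sqA U v w - phiVV p sqA U v' w)
      = hsNormSq (R w * (R v - R v')) := by
    intro v v' w
    rw [enormSq, Fintype.sum_prod_type, Finset.sum_comm]
    simp only [Pi.sub_apply, hphi, Matrix.mul_sub, hsNormSq, Matrix.sub_apply]
  have hself : ∀ v, enormSq (phiVV p sqA U v v) = hsNormSq (R v * R v) := by
    intro v
    rw [enormSq, Fintype.sum_prod_type, Finset.sum_comm]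
    simp only [hphi, hsNormSq]
  have hbra : ∀ v w, (braket (diagState p) (mconj (A v) ⊗ₖ A w)).re
      = ((R v * R v) * (R w * R w)).trace.re := by
    intro v w
    rw [braket_diagState, ← hsqrt, (hR v).2.1, (hR w).2.1, (hA v).1.1.eq]
    congr 1
    calc _ = (rho4 * (rho4 * A w * rho4 * (rho4 * A v))).trace := by
          simp only [Matrix.mul_assoc]
      _ = ((rho4 * A w * rho4) * (rho4 * A v * rho4)).trace := by
          rw [Matrix.trace_mul_comm]
          simp only [Matrix.mul_assoc]
      _ = _ := Matrix.trace_mul_comm _ _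
  have hbra' : ∀ v, (braket (diagState p) (mconj (A v) ⊗ₖ A v)).re = hsNormSq (R v * R v) := by
    intro v
    rw [hbra, hsNormSq_eq_re_trace, (hRR v).eq]
  simp only [hbra'] at hcorr
  simp only [hbra] at hcorr
  simp only [hdiff, hself]
  set S : ℝ := ∑ v, (∑ w, ν v w) * hsNormSq (R v * R v) with hS
  have hSleft : ∑ v, ∑ w, ν v w * hsNormSq (R v * R v) = S := by
    simp only [hS, Finset.sum_mul]
  have hSright : ∑ v, ∑ w, ν v w * hsNormSq (R w * R w) = S := by
    rw [Finset.sum_comm, ← hSleft]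
    simp only [fun v w => hsymm w v]
  have hS0 : 0 ≤ S := Finset.sum_nonneg fun v _ =>
    mul_nonneg (Finset.sum_nonneg fun w _ => hν v w) (hsNormSq_nonneg _)
  have hN : ∑ v, ∑ w, ν v w * hsNormSq (R v * R v - R w * R w) ≤ 2 * (η * S) := by
    have e : ∑ v, ∑ w, ν v w * hsNormSq (R v * R v - R w * R w)
        = S + S - 2 * ∑ v, ∑ w, ν v w * ((R v * R v) * (R w * R w)).trace.re := by
      nth_rewrite 1 [← hSleft]
      rw [← hSright]
      simp only [Finset.mul_sum, ← Finset.sum_add_distrib, ← Finset.sum_sub_distrib]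
      refine Finset.sum_congr rfl fun v _ => Finset.sum_congr rfl fun w _ => ?_
      rw [hsNormSq_sub (hRR v) (hRR w)]
      ring
    rw [e]
    linarith
  have hNsqrt : Real.sqrt (∑ v, ∑ w, ν v w * hsNormSq (R v * R v - R w * R w))
      ≤ 2 * Real.sqrt η * Real.sqrt S := by
    refine Real.sqrt_le_iff.mpr ⟨by positivity, hN.trans ?_⟩
    rw [mul_pow, mul_pow, Real.sq_sqrt hη.le, Real.sq_sqrt hS0]
    nlinarith [mul_nonneg hη.le hS0]
  have main : ∀ T : V → Mat d, (∀ v, (T v).IsHermitian) →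
      ∑ v, ∑ w, ν v w * hsNormSq (T v * (R v - R w)) ≤
        Real.sqrt (∑ v, ∑ w, ν v w * hsNormSq (T v * T v)) *
          (2 * Real.sqrt η * Real.sqrt S) := by
    intro T hT
    have h := sum_sum_mul_mul_le_sqrt_mul_sqrt hν
      (fun v _ => Real.sqrt (hsNormSq (T v * T v)))
      (fun v w => Real.sqrt (hsNormSq (R v * R v - R w * R w)))
    simp only [Real.sq_sqrt (hsNormSq_nonneg _)] at h
    refine le_trans ?_ (h.trans (mul_le_mul_of_nonneg_left hNsqrt (Real.sqrt_nonneg _)))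
    refine Finset.sum_le_sum fun v _ => Finset.sum_le_sum fun w _ => ?_
    exact mul_le_mul_of_nonneg_left (hsNormSq_mul_sub_le (hT v) (hR v).1 (hR w).1) (hν v w)
  constructor
  · intro u
    refine (main (fun _ => R u) fun _ => (hR u).1.1).trans (le_of_eq ?_)
    simp only [← Finset.sum_mul, hsum, one_mul]
    ring
  · refine (main R fun v => (hR v).1.1).trans (le_of_eq ?_)
    rw [hSleft, mul_left_comm, Real.mul_self_sqrt hS0]
end
end
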